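/- arXiv:1909.00969 — 2 statements merged into one kernel-verified Lean document; each statement's English description precedes it below -/
import Mathlib

section
/- Let α be an irrational real number such that e^{2πiα} is an algebraic number. Then α is a transcendental number. -/
/-- `e(α) = e^{2πiα}`. -/
noncomputable def e2pi (α : ℝ) : ℂ := Complex.exp (2 * (Real.pi : ℂ) * Complex.I * (α : ℂ))

theorem Differentiable.exists_eq_sub_pow_mul {f : ℂ → ℂ} (hf : Differentiable ℂ f) {c : ℂ} {r : ℕ}
    (h : r ≤ analyticOrderAt f c) :
    ∃ g : ℂ → ℂ, Differentiable ℂ g ∧ ∀ z, f z = (z - c) ^ r * g z := by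
  induction r generalizing f with
  | zero => exact ⟨f, hf, by simp⟩
  | succ r ih =>
    have hfc : f c = 0 := by
      refine apply_eq_zero_of_analyticOrderAt_ne_zero fun h0 ↦ ?_
      simp [h0] at h
    have hd : Differentiable ℂ (dslope f c) := by
      rw [← differentiableOn_univ] at hf ⊢
      exact (Complex.differentiableOn_dslope Filter.univ_mem).2 hf
    have hfg : f = (fun z ↦ z - c) * dslope f c := by
      ext z
      simpa [hfc] using (sub_smul_dslope f c z).symm
    have hord : analyticOrderAt f c = 1 + analyticOrderAt (dslope f c) c := by
      conv_lhs => rw [hfg]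
      rw [analyticOrderAt_mul (by fun_prop) (hd.analyticAt c)]
      congr 1
      exact analyticOrderAt_id_sub_const_self
    obtain ⟨g, hg, hgf⟩ := ih hd <| by
      rw [hord, add_comm 1] at h
      push_cast at h
      exact (ENat.add_le_add_iff_right ENat.one_ne_top).1 h
    refine ⟨g, hg, fun z ↦ ?_⟩
    rw [hfg, Pi.mul_apply, hgf]
    ring

theorem Differentiable.exists_eq_prod_sub_pow_mul {f : ℂ → ℂ} (hf : Differentiable ℂ f)
    {S : Finset ℂ} {r : ℕ} (h : ∀ c ∈ S, r ≤ analyticOrderAt f c) :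
    ∃ g : ℂ → ℂ, Differentiable ℂ g ∧ ∀ z, f z = (∏ c ∈ S, (z - c)) ^ r * g z := by
  induction S using Finset.induction_on generalizing f with
  | empty => exact ⟨f, hf, by simp⟩
  | insert c S hc ih =>
    obtain ⟨g, hg, hfg⟩ := hf.exists_eq_sub_pow_mul (h c (S.mem_insert_self c))
    obtain ⟨u, hu, hgu⟩ := ih hg fun t ht ↦ by
      have htc : t - c ≠ 0 := sub_ne_zero.2 fun e ↦ hc (e ▸ ht)
      have hord : analyticOrderAt f t = analyticOrderAt g t := by
        rw [show f = (fun z ↦ (z - c) ^ r) * g from funext hfg,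
          analyticOrderAt_mul (by fun_prop) (hg.analyticAt t),
          (by fun_prop : AnalyticAt ℂ (fun z ↦ (z - c) ^ r) t).analyticOrderAt_eq_zero.2
            (pow_ne_zero r htc), zero_add]
      exact hord ▸ h t (Finset.mem_insert_of_mem ht)
    refine ⟨u, hu, fun z ↦ ?_⟩
    rw [hfg, hgu, Finset.prod_insert hc, mul_pow, mul_assoc]

open Metric in
/-- A Schwarz lemma for entire functions with many zeros of high order in a small disc. -/
theorem Differentiable.norm_iteratedDeriv_le_of_zeros {f : ℂ → ℂ} (hf : Differentiable ℂ f)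
    {S : Finset ℂ} {r : ℕ} {ρ R B : ℝ} (hS : ∀ c ∈ S, ‖c‖ ≤ ρ) (hR : ρ + 1 ≤ R)
    (hzero : ∀ c ∈ S, ∀ k < r, iteratedDeriv k f c = 0)
    (hB : ∀ z : ℂ, ‖z‖ = R → ‖f z‖ ≤ B) {t : ℂ} (ht : t ∈ S) :
    ‖iteratedDeriv r f t‖ ≤ r.factorial * ((((2 * ρ + 1) / (R - ρ)) ^ S.card) ^ r * B) := by
  have hρ : 0 ≤ ρ := (norm_nonneg t).trans (hS t ht)
  obtain ⟨g, hg, hfg⟩ := hf.exists_eq_prod_sub_pow_mul (S := S) (r := r) fun c hc ↦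
    (natCast_le_analyticOrderAt_iff_iteratedDeriv_eq_zero (hf.analyticAt c)).2 (hzero c hc)
  have hbound : ∀ z : ℂ, ‖z‖ ≤ R → ‖g z‖ ≤ B / ((R - ρ) ^ S.card) ^ r := by
    intro z hz
    refine Complex.norm_le_of_forall_mem_frontier_norm_le (U := ball 0 R) isBounded_ball
      hg.diffContOnCl (fun w hw ↦ ?_) ?_
    · rw [frontier_ball _ (by linarith), mem_sphere_zero_iff_norm] at hw
      have h1 : (R - ρ) ^ S.card ≤ ∏ c ∈ S, ‖w - c‖ := by
        rw [← Finset.prod_const]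
        refine Finset.prod_le_prod (fun _ _ ↦ by linarith) fun c hc ↦ ?_
        have := norm_sub_norm_le w c
        have := hS c hc
        linarith
      have h2 : 0 < (R - ρ) ^ S.card := pow_pos (by linarith) _
      rw [le_div_iff₀ (by positivity)]
      calc ‖g w‖ * ((R - ρ) ^ S.card) ^ r ≤ ‖g w‖ * (∏ c ∈ S, ‖w - c‖) ^ r := by gcongr
        _ = ‖f w‖ := by rw [hfg, norm_mul, norm_pow, norm_prod, mul_comm]
        _ ≤ B := hB w hw
    · rw [closure_ball _ (by linarith)]
      simpa using hz
  have hfin := Complex.norm_iteratedDeriv_le_of_forall_mem_sphere_norm_le (c := t) (R := 1)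
    (C := (((2 * ρ + 1) / (R - ρ)) ^ S.card) ^ r * B) r one_pos hf.diffContOnCl fun z hz ↦ by
      rw [mem_sphere_iff_norm] at hz
      have hzρ : ‖z‖ ≤ ρ + 1 := by
        have := norm_le_norm_add_norm_sub' z t
        have := hS t ht
        linarith
      have h1 : ∏ c ∈ S, ‖z - c‖ ≤ (2 * ρ + 1) ^ S.card := by
        rw [← Finset.prod_const]
        refine Finset.prod_le_prod (fun _ _ ↦ norm_nonneg _) fun c hc ↦ ?_
        have := norm_sub_le z c
        have := hS c hc
        linarith
      calc ‖f z‖ = (∏ c ∈ S, ‖z - c‖) ^ r * ‖g z‖ := by rw [hfg, norm_mul, norm_pow, norm_prod]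
        _ ≤ ((2 * ρ + 1) ^ S.card) ^ r * (B / ((R - ρ) ^ S.card) ^ r) :=
          mul_le_mul (by gcongr) (hbound z (hzρ.trans hR)) (norm_nonneg _) (by positivity)
        _ = _ := by rw [div_pow, div_pow]; ring
  simpa using hfin

theorem iteratedDeriv_sum_mul_cexp {ι : Type*} (s : Finset ι) (a w : ι → ℂ) (k : ℕ) (z : ℂ) :
    iteratedDeriv k (fun z ↦ ∑ i ∈ s, a i * Complex.exp (w i * z)) z =
      ∑ i ∈ s, a i * (w i ^ k * Complex.exp (w i * z)) := by
  rw [iteratedDeriv_fun_sum fun i _ ↦ by fun_prop]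
  refine Finset.sum_congr rfl fun i _ ↦ ?_
  rw [iteratedDeriv_const_mul_field, iteratedDeriv_cexp_const_mul]

theorem eq_zero_of_forall_sum_mul_pow_eq_zero {R ι : Type*} [CommRing R] [IsDomain R] [Fintype ι]
    {f v : ι → R} (hf : Function.Injective f) (h : ∀ k : ℕ, ∑ j, v j * f j ^ k = 0) : v = 0 := by
  let e := Fintype.equivFin ι
  have := Matrix.eq_zero_of_forall_pow_sum_mul_pow_eq_zero (f := f ∘ e.symm) (v := v ∘ e.symm)
    (hf.comp e.symm.injective) fun i ↦ by
      simpa using (e.symm.sum_comp fun j ↦ v j * f j ^ (i : ℕ)).trans (h i)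
  ext j
  simpa using congrFun this (e j)

open NumberField

theorem NumberField.one_le_norm_mul_house_pow {K : Type*} [Field K] [NumberField K] {x : 𝓞 K}
    (hx : x ≠ 0) (σ : K →+* ℂ) :
    1 ≤ ‖σ x‖ * house (x : K) ^ (Module.finrank ℚ K - 1) := by
  refine le_trans ?_ (norm_norm_le_norm_mul_house_pow (x : K) σ)
  rw [← Algebra.coe_norm_int, ← Rat.norm_cast_real, Rat.cast_intCast, Real.norm_eq_abs]
  exact_mod_cast Int.one_le_abs (Algebra.norm_ne_zero_iff.2 hx)

/-- Siegel's lemma over a number field, for twice as many unknowns as equations. -/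
theorem NumberField.exists_siegel_const (K : Type*) [Field K] [NumberField K] :
    ∃ C : ℝ, 1 ≤ C ∧ ∀ {ι κ : Type} [Fintype ι] [Fintype κ] [Nonempty ι] (a : Matrix ι κ (𝓞 K))
      {A : ℝ}, Fintype.card κ = 2 * Fintype.card ι → a ≠ 0 →
      (∀ i j, house (a i j : K) ≤ A) → ∃ ξ : κ → 𝓞 K, ξ ≠ 0 ∧ a.mulVec ξ = 0 ∧
        ∀ j, house (ξ j : K) ≤ C * (C * Fintype.card κ * A) := by
  classical
  have key : ∃ c : ℝ, ∀ {ι κ : Type} [Fintype ι] [Fintype κ] [Nonempty ι] (a : Matrix ι κ (𝓞 K))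
      {A : ℝ}, Fintype.card κ = 2 * Fintype.card ι → a ≠ 0 →
      (∀ i j, house (a i j : K) ≤ A) → ∃ ξ : κ → 𝓞 K, ξ ≠ 0 ∧ a.mulVec ξ = 0 ∧
        ∀ j, house (ξ j : K) ≤ c * ((c * Fintype.card κ * A) ^
          ((Fintype.card ι : ℝ) / (Fintype.card κ - Fintype.card ι))) :=
    ⟨_, fun {ι κ} _ _ _ a _ hcard ha hA ↦ house.exists_ne_zero_int_vec_house_le K a ha
      Fintype.card_pos (by have := Fintype.card_pos (α := ι); omega) rfl hA rfl⟩
  obtain ⟨c, hc⟩ := key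
  refine ⟨1 + |c|, by simp, fun {ι κ} _ _ _ a A hcard ha hA ↦ ?_⟩
  obtain ⟨ξ, hξ, haξ, hle⟩ := hc a hcard ha hA
  refine ⟨ξ, hξ, haξ, fun j ↦ (hle j).trans ?_⟩
  have hι : (0 : ℝ) < Fintype.card ι := mod_cast Fintype.card_pos
  have hexp : (Fintype.card ι : ℝ) / (Fintype.card κ - Fintype.card ι) = 1 := by
    rw [hcard, div_eq_one_iff_eq] <;> push_cast <;> linarith
  have hA0 : 0 ≤ A := (house_nonneg _).trans (hA (Classical.arbitrary ι) j)
  rw [hexp, Real.rpow_one]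
  calc c * (c * Fintype.card κ * A) = |c| * (|c| * Fintype.card κ * A) := by
        rw [← mul_assoc, ← mul_assoc, ← mul_assoc, ← mul_assoc, abs_mul_abs_self]
    _ ≤ (1 + |c|) * ((1 + |c|) * Fintype.card κ * A) := by gcongr <;> linarith

theorem NumberField.RingOfIntegers.coe_finset_sum {K ι : Type*} [Field K] (s : Finset ι)
    (f : ι → 𝓞 K) : ((∑ i ∈ s, f i : 𝓞 K) : K) = ∑ i ∈ s, (f i : K) :=
  map_sum (algebraMap (𝓞 K) K) f s

section GelfondSchneider

open Complex

variable {K : Type*} [Field K]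

/-- The algebraic integer `c ^ (k + 2 * N) * (a + b * α) ^ k * β ^ (a * t) * γ ^ (b * t)`, where
`α = x / c`, `β = y / c`, `γ = z / c` and `p = (a, b)`. -/
def gelfondCoeff (c : ℕ) (x y z : 𝓞 K) (N k t : ℕ) (p : ℕ × ℕ) : 𝓞 K :=
  (p.1 * c + p.2 * x) ^ k * (y ^ (p.1 * t) * c ^ (N - p.1 * t)) *
    (z ^ (p.2 * t) * c ^ (N - p.2 * t))

/-- The frequency `(a + b * x / c) * l` for `p = (a, b)`. -/
noncomputable def gelfondFreq (c : ℕ) (x l : ℂ) (p : ℕ × ℕ) : ℂ := (p.1 + p.2 * (x / c)) * l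

theorem gelfondFreq_pow_mul_exp {c : ℕ} (hc : 0 < c) {x y z : 𝓞 K} {l : ℂ} {σ : K →+* ℂ}
    (hy : exp l = σ y / c) (hz : exp (σ x / c * l) = σ z / c) {N t : ℕ} {p : ℕ × ℕ}
    (h1 : p.1 * t ≤ N) (h2 : p.2 * t ≤ N) (k : ℕ) :
    l ^ k * σ (gelfondCoeff c x y z N k t p) =
      c ^ (k + 2 * N) * (gelfondFreq c (σ x) l p ^ k * exp (gelfondFreq c (σ x) l p * t)) := by
  have hc' : (c : ℂ) ≠ 0 := by exact_mod_cast hc.ne'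
  have hexp : exp (gelfondFreq c (σ x) l p * t) =
      (σ y / c) ^ (p.1 * t) * (σ z / c) ^ (p.2 * t) := by
    rw [← hy, ← hz, ← exp_nat_mul, ← exp_nat_mul, ← exp_add, gelfondFreq]
    push_cast
    ring_nf
  have hbase : (p.1 * c + p.2 * σ x : ℂ) * l = c * gelfondFreq c (σ x) l p := by
    rw [gelfondFreq]
    field_simp
  have hpow : ∀ (w : ℂ) {j : ℕ}, j ≤ N → w ^ j * c ^ (N - j) = c ^ N * (w / c) ^ j := by
    intro w j hj
    rw [div_pow, ← Nat.sub_add_cancel hj, pow_add, Nat.add_sub_cancel]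
    field_simp
  simp only [gelfondCoeff, map_mul, map_add, map_pow, map_natCast]
  rw [hexp, hpow _ h1, hpow _ h2]
  have hbase' := congrArg (· ^ k) hbase
  simp only [mul_pow] at hbase'
  linear_combination
    (c ^ N * (σ y / c) ^ (p.1 * t) * (c ^ N * (σ z / c) ^ (p.2 * t))) * hbase'

variable [NumberField K]

theorem house_gelfondCoeff_le {c : ℕ} {x y z : 𝓞 K} {M : ℝ} (hM : 1 ≤ M) (hcM : c ≤ M)
    (hx : house (x : K) ≤ M) (hy : house (y : K) ≤ M) (hz : house (z : K) ≤ M)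
    {q N t : ℕ} {p : ℕ × ℕ} (hp1 : p.1 ≤ q) (hp2 : p.2 ≤ q) (h1 : p.1 * t ≤ N)
    (h2 : p.2 * t ≤ N) (k : ℕ) :
    house (gelfondCoeff c x y z N k t p : K) ≤ (2 * M * q) ^ k * M ^ (2 * N) := by
  have hnat : ∀ n : ℕ, house (n : K) = n := fun n ↦ by
    simpa using house_intCast (K := K) n
  have hpow : ∀ {u : K} {j : ℕ}, house u ≤ M → j ≤ N →
      house (u ^ j * (c : K) ^ (N - j)) ≤ M ^ N := by
    intro u j hu hj
    calc house (u ^ j * (c : K) ^ (N - j)) ≤ house (u ^ j) * house ((c : K) ^ (N - j)) :=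
          house_mul_le _ _
      _ ≤ house u ^ j * house (c : K) ^ (N - j) :=
          mul_le_mul (house_pow_le _ _) (house_pow_le _ _) (house_nonneg _)
            (pow_nonneg (house_nonneg _) _)
      _ ≤ M ^ j * M ^ (N - j) := by
          rw [hnat]
          gcongr
          exact house_nonneg _
      _ = M ^ N := by rw [← pow_add, Nat.add_sub_cancel' hj]
  have hbase : house ((p.1 : K) * c + p.2 * x) ≤ 2 * M * q := by
    have hp1' : (p.1 : ℝ) ≤ q := mod_cast hp1
    have hp2' : (p.2 : ℝ) ≤ q := mod_cast hp2
    calc house ((p.1 : K) * c + p.2 * x) ≤ house ((p.1 : K) * c) + house ((p.2 : K) * x) :=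
          house_add_le _ _
      _ ≤ p.1 * c + p.2 * house (x : K) := by
          rw [house_nat_mul, house_nat_mul, hnat]
      _ ≤ q * M + q * M := by
          gcongr
          exact house_nonneg _
      _ = 2 * M * q := by ring
  have hcoe : (gelfondCoeff c x y z N k t p : K) = ((p.1 : K) * c + p.2 * x) ^ k *
      ((y : K) ^ (p.1 * t) * (c : K) ^ (N - p.1 * t)) *
      ((z : K) ^ (p.2 * t) * (c : K) ^ (N - p.2 * t)) := by
    simp [gelfondCoeff]
  rw [hcoe]
  calc _ ≤ house (((p.1 : K) * c + p.2 * x) ^ k) *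
        house ((y : K) ^ (p.1 * t) * (c : K) ^ (N - p.1 * t)) *
        house ((z : K) ^ (p.2 * t) * (c : K) ^ (N - p.2 * t)) :=
        (house_mul_le _ _).trans
          (mul_le_mul_of_nonneg_right (house_mul_le _ _) (house_nonneg _))
    _ ≤ (2 * M * q) ^ k * M ^ N * M ^ N := by
        have := (house_pow_le ((p.1 : K) * c + p.2 * x) k).trans
          (pow_le_pow_left₀ (house_nonneg _) hbase k)
        gcongr
        exacts [house_nonneg _, house_nonneg _, hpow hy h1, hpow hz h2]
    _ = (2 * M * q) ^ k * M ^ (2 * N) := by ring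

/-- The index `(a, b)` of a pair of elements of `Fin q`. -/
abbrev finPairVal {q : ℕ} (p : Fin q × Fin q) : ℕ × ℕ := (p.1, p.2)

theorem finPairVal_mul_le {q m t : ℕ} (p : Fin q × Fin q) (ht : t < m) :
    (finPairVal p).1 * t ≤ m * q ∧ (finPairVal p).2 * t ≤ m * q := by
  rw [mul_comm m]
  exact ⟨Nat.mul_le_mul p.1.2.le ht.le, Nat.mul_le_mul p.2.2.le ht.le⟩

/-- The coefficients of an exponential polynomial vanishing to order `n` at `0, …, m - 1`. -/
theorem exists_gelfond_auxiliary {c : ℕ} (hc : 0 < c) {x y z : 𝓞 K} {M C : ℝ} (hM : 1 ≤ M)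
    (hcM : c ≤ M) (hx : house (x : K) ≤ M) (hy : house (y : K) ≤ M) (hz : house (z : K) ≤ M)
    (hC : ∀ {ι κ : Type} [Fintype ι] [Fintype κ] [Nonempty ι] (a : Matrix ι κ (𝓞 K))
      {A : ℝ}, Fintype.card κ = 2 * Fintype.card ι → a ≠ 0 →
      (∀ i j, house (a i j : K) ≤ A) → ∃ ξ : κ → 𝓞 K, ξ ≠ 0 ∧ a.mulVec ξ = 0 ∧
        ∀ j, house (ξ j : K) ≤ C * (C * Fintype.card κ * A))
    {q m n : ℕ} (hm : 0 < m) (hn : 0 < n) (hq : q * q = 2 * (n * m)) :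
    ∃ η : Fin q × Fin q → 𝓞 K, η ≠ 0 ∧
      (∀ k < n, ∀ t < m, ∑ p, η p * gelfondCoeff c x y z (m * q) k t (finPairVal p) = 0) ∧
      ∀ p, house (η p : K) ≤ C * (C * (q * q) * ((2 * M * q) ^ n * M ^ (2 * (m * q)))) := by
  have hq0 : 0 < q := Nat.pos_of_ne_zero fun h ↦ by
    have := Nat.mul_pos hn hm
    simp [h] at hq
    omega
  have : Nonempty (Fin n × Fin m) := ⟨⟨0, hn⟩, ⟨0, hm⟩⟩
  obtain ⟨η, hη, hmul, hle⟩ := hC (ι := Fin n × Fin m) (κ := Fin q × Fin q)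
    (Matrix.of fun i p ↦ gelfondCoeff c x y z (m * q) i.1 i.2 (finPairVal p))
    (A := (2 * M * q) ^ n * M ^ (2 * (m * q))) (by simpa using hq)
    (fun h ↦ by
      have := congrFun (congrFun h (⟨0, hn⟩, ⟨0, hm⟩)) (⟨0, hq0⟩, ⟨0, hq0⟩)
      simp [gelfondCoeff, hc.ne'] at this)
    (fun i p ↦ by
      obtain ⟨h1, h2⟩ := finPairVal_mul_le p i.2.2
      refine (house_gelfondCoeff_le hM hcM hx hy hz p.1.2.le p.2.2.le h1 h2 i.1).trans ?_
      have hqr : (1 : ℝ) ≤ q := mod_cast hq0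
      gcongr
      · nlinarith
      · exact i.1.2.le)
  refine ⟨η, hη, fun k hk t ht ↦ ?_, by simpa using hle⟩
  simpa [Matrix.mulVec, dotProduct, mul_comm] using congrFun hmul (⟨k, hk⟩, ⟨t, ht⟩)

theorem exists_min_gelfondCoeff_sum_ne_zero {c : ℕ} (hc : 0 < c) {x y z : 𝓞 K}
    (hinj : Function.Injective fun p : ℕ × ℕ ↦ (p.1 * c + p.2 * x : 𝓞 K)) {q m N : ℕ}
    (hm : 0 < m) {η : Fin q × Fin q → 𝓞 K} (hη : η ≠ 0) :
    ∃ r, (∃ t < m, ∑ p, η p * gelfondCoeff c x y z N r t (finPairVal p) ≠ 0) ∧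
      ∀ k < r, ∀ t < m, ∑ p, η p * gelfondCoeff c x y z N k t (finPairVal p) = 0 := by
  classical
  have hex : ∃ r, ∃ t < m, ∑ p, η p * gelfondCoeff c x y z N r t (finPairVal p) ≠ 0 := by
    by_contra! h
    refine hη (eq_zero_of_forall_sum_mul_pow_eq_zero
      (f := fun p : Fin q × Fin q ↦ ((p.1 : ℕ) * c + (p.2 : ℕ) * x : 𝓞 K)) (fun p p' hp ↦ ?_)
      fun k ↦ ?_)
    · have := @hinj (finPairVal p) (finPairVal p') hp
      simpa [Prod.ext_iff, Fin.ext_iff] using this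
    · have := h k 0 hm
      simp only [gelfondCoeff, mul_zero, pow_zero, one_mul, Nat.sub_zero, ← mul_assoc,
        ← Finset.sum_mul] at this
      simpa [hc.ne'] using this
  refine ⟨Nat.find hex, Nat.find_spec hex, fun k hk t ht ↦ ?_⟩
  by_contra h
  exact Nat.find_min hex hk ⟨t, ht, h⟩

theorem house_gelfond_sum_le {c : ℕ} {x y z : 𝓞 K} {M H : ℝ} (hM : 1 ≤ M) (hcM : c ≤ M)
    (hx : house (x : K) ≤ M) (hy : house (y : K) ≤ M) (hz : house (z : K) ≤ M) {q m r t : ℕ}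
    (ht : t < m) {η : Fin q × Fin q → 𝓞 K} (hη : ∀ p, house (η p : K) ≤ H) :
    house ((∑ p, η p * gelfondCoeff c x y z (m * q) r t (finPairVal p) : 𝓞 K) : K) ≤
      q * q * (H * ((2 * M * q) ^ r * M ^ (2 * (m * q)))) := by
  rw [RingOfIntegers.coe_finset_sum]
  refine (house_sum_le_sum_house _ _).trans ?_
  refine (Finset.sum_le_card_nsmul _ _ (H * ((2 * M * q) ^ r * M ^ (2 * (m * q))))
    fun p _ ↦ ?_).trans_eq (by simp)
  obtain ⟨h1, h2⟩ := finPairVal_mul_le p ht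
  refine (house_mul_le _ _).trans (mul_le_mul (hη p)
    (house_gelfondCoeff_le hM hcM hx hy hz p.1.2.le p.2.2.le h1 h2 r) (house_nonneg _)
    ((house_nonneg _).trans (hη p)))

theorem norm_gelfond_sum_le {c : ℕ} (hc : 0 < c) {x y z : 𝓞 K} {l : ℂ} (hl : l ≠ 0)
    {σ : K →+* ℂ} (hy : exp l = σ y / c) (hz : exp (σ x / c * l) = σ z / c) {q m r t : ℕ}
    (ht : t < m) {η : Fin q × Fin q → 𝓞 K} {H R : ℝ} (hη : ∀ p, house (η p : K) ≤ H)
    (hR : (m : ℝ) + 1 ≤ R)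
    (hzero : ∀ k < r, ∀ t < m, ∑ p, η p * gelfondCoeff c x y z (m * q) k t (finPairVal p) = 0) :
    ‖σ (∑ p, η p * gelfondCoeff c x y z (m * q) r t (finPairVal p) : 𝓞 K)‖ ≤
      c ^ (r + 2 * (m * q)) * ‖l‖⁻¹ ^ r * (r.factorial * ((((2 * m + 1) / (R - m)) ^ m) ^ r *
        (q * q * (H * Real.exp ((1 + ‖σ x / c‖) * ‖l‖ * (q * R)))))) := by
  set w : Fin q × Fin q → ℂ := fun p ↦ gelfondFreq c (σ x) l (finPairVal p)
  set f : ℂ → ℂ := fun u ↦ ∑ p, σ (η p) * exp (w p * u)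
  have hf : Differentiable ℂ f := by fun_prop
  have hderiv : ∀ k, ∀ t < m, l ^ k * σ (∑ p, η p * gelfondCoeff c x y z (m * q) k t
      (finPairVal p) : 𝓞 K) = c ^ (k + 2 * (m * q)) * iteratedDeriv k f t := by
    intro k t ht
    rw [iteratedDeriv_sum_mul_cexp, RingOfIntegers.coe_finset_sum, map_sum, Finset.mul_sum,
      Finset.mul_sum]
    refine Finset.sum_congr rfl fun p _ ↦ ?_
    obtain ⟨h1, h2⟩ := finPairVal_mul_le p ht
    have := gelfondFreq_pow_mul_exp hc hy hz h1 h2 k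
    rw [RingOfIntegers.coe_eq_algebraMap, map_mul, map_mul, mul_left_comm, this, mul_left_comm]
  have hvanish : ∀ k < r, ∀ t < m, iteratedDeriv k f t = 0 := by
    intro k hk t ht
    have := hderiv k t ht
    rw [hzero k hk t ht, RingOfIntegers.coe_eq_algebraMap, map_zero, map_zero, mul_zero] at this
    simpa [hc.ne'] using this.symm
  have hwle : ∀ p, ‖w p‖ ≤ q * ((1 + ‖σ x / c‖) * ‖l‖) := by
    intro p
    have hp1 : ((p.1 : ℕ) : ℝ) ≤ q := mod_cast p.1.2.le
    have hp2 : ((p.2 : ℕ) : ℝ) ≤ q := mod_cast p.2.2.le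
    calc ‖w p‖ = ‖((p.1 : ℕ) : ℂ) + (p.2 : ℕ) * (σ x / c)‖ * ‖l‖ := norm_mul _ _
      _ ≤ (‖((p.1 : ℕ) : ℂ)‖ + ‖((p.2 : ℕ) : ℂ) * (σ x / c)‖) * ‖l‖ := by
          gcongr
          exact norm_add_le _ _
      _ ≤ (q + q * ‖σ x / c‖) * ‖l‖ := by
          rw [norm_mul, Complex.norm_natCast, Complex.norm_natCast]
          gcongr
      _ = _ := by ring
  have hR0 : 0 ≤ R := by
    have : (0 : ℝ) ≤ m := m.cast_nonneg
    linarith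
  have hfB : ∀ u : ℂ, ‖u‖ = R →
      ‖f u‖ ≤ q * q * (H * Real.exp ((1 + ‖σ x / c‖) * ‖l‖ * (q * R))) := by
    intro u hu
    refine (norm_sum_le _ _).trans ((Finset.sum_le_card_nsmul _ _
      (H * Real.exp ((1 + ‖σ x / c‖) * ‖l‖ * (q * R))) fun p _ ↦ ?_).trans_eq (by simp))
    rw [norm_mul]
    refine mul_le_mul ((norm_embedding_le_house _ σ).trans (hη p)) ?_ (norm_nonneg _)
      ((house_nonneg _).trans (hη p))
    refine (norm_exp_le_exp_norm _).trans (Real.exp_le_exp.2 ?_)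
    rw [norm_mul, hu]
    calc ‖w p‖ * R ≤ q * ((1 + ‖σ x / c‖) * ‖l‖) * R := by
          gcongr
          exact hwle p
      _ = _ := by ring
  have hcard : ((Finset.range m).map Nat.castEmbedding : Finset ℂ).card = m := by simp
  have hmain := hf.norm_iteratedDeriv_le_of_zeros (S := (Finset.range m).map Nat.castEmbedding)
    (r := r) (ρ := m) (R := R) (t := t) (by
      simp only [Finset.mem_map, Finset.mem_range]
      rintro _ ⟨j, hj, rfl⟩
      simpa using hj.le) hR (by
      simp only [Finset.mem_map, Finset.mem_range]
      rintro _ ⟨j, hj, rfl⟩ k hk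
      exact hvanish k hk j hj) hfB (by simpa using ht)
  rw [hcard] at hmain
  have hS : σ (∑ p, η p * gelfondCoeff c x y z (m * q) r t (finPairVal p) : 𝓞 K) =
      c ^ (r + 2 * (m * q)) * l⁻¹ ^ r * iteratedDeriv r f t := by
    have h := hderiv r t ht
    rw [mul_right_comm, ← h, mul_right_comm, ← mul_pow, mul_inv_cancel₀ hl, one_pow, one_mul]
  rw [hS, norm_mul, norm_mul, norm_pow, norm_pow, Complex.norm_natCast, norm_inv]
  gcongr

theorem gelfond_bound {Q r F u : ℝ} {g : ℕ} (hF : 0 ≤ F) (hr : 0 < r) (hQ : 0 ≤ Q)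
    (hQr : Q * Q ≤ u * r)
    (h : 1 ≤ F * (r * (Q / r) ^ (2 * g + 5) * Q * (Q * Q) ^ g)) :
    r ≤ F * u ^ (2 * g + 3) := by
  have h1 : r ^ (2 * g + 5) ≤ F * r * (Q * Q) ^ (2 * g + 3) := by
    calc r ^ (2 * g + 5) = r ^ (2 * g + 5) * 1 := (mul_one _).symm
      _ ≤ r ^ (2 * g + 5) * (F * (r * (Q / r) ^ (2 * g + 5) * Q * (Q * Q) ^ g)) := by gcongr
      _ = F * r * (Q * Q) ^ (2 * g + 3) := by
        rw [div_pow]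
        field_simp
        ring
  have h2 : F * r * (Q * Q) ^ (2 * g + 3) ≤ F * u ^ (2 * g + 3) * r ^ (2 * g + 4) := by
    calc F * r * (Q * Q) ^ (2 * g + 3) ≤ F * r * (u * r) ^ (2 * g + 3) := by gcongr
      _ = F * u ^ (2 * g + 3) * r ^ (2 * g + 4) := by ring
  refine le_of_mul_le_mul_right ?_ (pow_pos hr (2 * g + 4))
  calc r * r ^ (2 * g + 4) = r ^ (2 * g + 5) := by ring
    _ ≤ _ := h1.trans h2

theorem gelfond_contradiction {c : ℕ} (hc : 0 < c) {x y z : 𝓞 K} {l : ℂ} (hl : l ≠ 0)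
    {σ : K →+* ℂ} (hy : exp l = σ y / c) (hz : exp (σ x / c * l) = σ z / c)
    (hinj : Function.Injective fun p : ℕ × ℕ ↦ (p.1 * c + p.2 * x : 𝓞 K)) : False := by
  obtain ⟨C, hC1, hC⟩ := exists_siegel_const K
  obtain ⟨M, hM, hcM, hxM, hyM, hzM⟩ : ∃ M : ℝ, 1 ≤ M ∧ c ≤ M ∧ house (x : K) ≤ M ∧
      house (y : K) ≤ M ∧ house (z : K) ≤ M := by
    have := house_nonneg (x : K)
    have := house_nonneg (y : K)
    have := house_nonneg (z : K)
    have : (0 : ℝ) ≤ c := c.cast_nonneg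
    exact ⟨1 + c + house (x : K) + house (y : K) + house (z : K),
      by linarith, by linarith, by linarith, by linarith, by linarith⟩
  obtain ⟨g, hg⟩ : ∃ g, Module.finrank ℚ K = g + 1 :=
    Nat.exists_eq_add_one.2 Module.finrank_pos
  obtain ⟨m, hm⟩ : ∃ m, m = 2 * g + 5 := ⟨_, rfl⟩
  have hm1 : (1 : ℝ) ≤ m := by
    rw [hm]
    push_cast
    have : (0 : ℝ) ≤ g := g.cast_nonneg
    linarith
  have hc1 : (1 : ℝ) ≤ c := mod_cast hc
  set L : ℝ := (1 + ‖σ x / c‖) * ‖l‖ with hL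
  have hL0 : 0 ≤ L := by positivity
  set H₀ : ℝ := C * (C * (4 * m) * (2 * M * M ^ (2 * m))) with hH₀
  set D : ℝ := 4 * m * (H₀ * (2 * M * M ^ (2 * m))) with hD
  set E : ℝ := c ^ (1 + 2 * m) * ‖l‖⁻¹ * ((2 * m + 1) ^ m * (4 * m * (H₀ * Real.exp (L * (m + 1)))))
    with hE
  have hC0 : 0 ≤ C := by linarith
  have hM0 : 0 ≤ M := by linarith
  have hH₀0 : 0 ≤ H₀ := by positivity
  have hD0 : 0 ≤ D := by positivity
  have hE0 : 0 ≤ E := by positivity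
  obtain ⟨s, hs⟩ := exists_nat_gt (E * D ^ g * (2 * m) ^ (2 * g + 3))
  have hs0 : 0 < s := by
    have : (0 : ℝ) < s := lt_of_le_of_lt (by positivity) hs
    exact_mod_cast this
  obtain ⟨q, hq⟩ : ∃ q, q = 2 * m * s := ⟨_, rfl⟩
  obtain ⟨n, hn⟩ : ∃ n, n = 2 * m * s * s := ⟨_, rfl⟩
  have hm0 : 0 < m := by omega
  have hn0 : 0 < n := by rw [hn]; positivity
  have hq0 : 0 < q := by rw [hq]; positivity
  have hqn : q * q = 2 * (n * m) := by rw [hq, hn]; ring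
  obtain ⟨η, hη, hvan, hηle⟩ := exists_gelfond_auxiliary (x := x) (y := y) (z := z) hc hM hcM
    hxM hyM hzM hC hm0 hn0 hqn
  obtain ⟨r, ⟨t, ht, hne⟩, hmin⟩ :=
    exists_min_gelfondCoeff_sum_ne_zero (y := y) (z := z) (N := m * q) hc hinj hm0 hη
  have hnr : n ≤ r := by
    by_contra! h
    exact hne (hvan r h t ht)
  have hr0 : r ≠ 0 := by omega
  have hqr : q ≤ r := le_trans (by rw [hq, hn]; exact Nat.le_mul_of_pos_right _ hs0) hnr
  have hsr : s ≤ r := le_trans (by rw [hq]; exact Nat.le_mul_of_pos_left _ (by positivity)) hqr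
  have hrR : (0 : ℝ) < r := by exact_mod_cast Nat.pos_of_ne_zero hr0
  have hq1R : (1 : ℝ) ≤ q := mod_cast hq0
  have hqrR : (q : ℝ) ≤ r := mod_cast hqr
  have hqq : (q : ℝ) * q ≤ 2 * m * r := by
    have : q * q ≤ 2 * m * r := by rw [hqn]; nlinarith
    exact_mod_cast this
  have hself : ∀ {w : ℝ}, 1 ≤ w → w ≤ w ^ r := fun hw ↦ le_self_pow₀ hw hr0
  have hqqpow : (q : ℝ) * q ≤ (4 * m) ^ r := by
    have h2 : (r : ℝ) ≤ 2 ^ r := by exact_mod_cast Nat.lt_two_pow_self.le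
    calc (q : ℝ) * q ≤ 2 * m * r := hqq
      _ ≤ (2 * m) ^ r * 2 ^ r := by
        gcongr
        exact hself (by linarith)
      _ = (4 * m) ^ r := by rw [← mul_pow]; ring
  have hMpow : M ^ (2 * (m * q)) ≤ (M ^ (2 * m)) ^ r := by
    rw [← pow_mul]
    refine pow_le_pow_right₀ hM ?_
    rw [← mul_assoc]
    gcongr
  have hηH : ∀ p, house (η p : K) ≤ (H₀ * q) ^ r := by
    intro p
    refine (hηle p).trans ?_
    calc C * (C * (q * q) * ((2 * M * q) ^ n * M ^ (2 * (m * q))))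
        ≤ C ^ r * (C ^ r * (4 * m) ^ r * ((2 * M * q) ^ r * (M ^ (2 * m)) ^ r)) := by
          gcongr
          · exact hself hC1
          · exact hself hC1
          · nlinarith
      _ = (H₀ * q) ^ r := by
          simp only [← mul_pow]
          rw [hH₀]
          ring
  have hhouse := (house_gelfond_sum_le hM hcM hxM hyM hzM ht hηH).trans
    (show _ ≤ (D * (q * q)) ^ r by
      calc (q : ℝ) * q * ((H₀ * q) ^ r * ((2 * M * q) ^ r * M ^ (2 * (m * q))))
          ≤ (4 * m) ^ r * ((H₀ * q) ^ r * ((2 * M * q) ^ r * (M ^ (2 * m)) ^ r)) := by gcongr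
        _ = (D * (q * q)) ^ r := by
          simp only [← mul_pow]
          rw [hD]
          ring)
  have hrq : 1 ≤ (r : ℝ) / q := (one_le_div (by linarith)).2 hqrR
  have hnorm := (norm_gelfond_sum_le (R := m + r / q) hc hl hy hz ht hηH (by linarith) hmin).trans
    (show _ ≤ (E * (r * (q / r) ^ m * q)) ^ r by
      have hcpow : (c : ℝ) ^ (r + 2 * (m * q)) ≤ (c ^ (1 + 2 * m)) ^ r := by
        rw [← pow_mul]
        refine pow_le_pow_right₀ hc1 ?_
        nlinarith
      have hfac : (r.factorial : ℝ) ≤ r ^ r := mod_cast r.factorial_le_pow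
      have hexp : Real.exp (L * (q * (m + r / q))) ≤ Real.exp (L * (m + 1)) ^ r := by
        rw [← Real.exp_nat_mul]
        refine Real.exp_le_exp.2 ?_
        have : (q : ℝ) * (m + r / q) = m * q + r := by field_simp
        rw [this]
        calc L * (m * q + r) ≤ L * (m * r + r) := by gcongr
          _ = _ := by ring
      rw [add_sub_cancel_left]
      calc (c : ℝ) ^ (r + 2 * (m * q)) * ‖l‖⁻¹ ^ r * (r.factorial *
            ((((2 * m + 1) / (r / q)) ^ m) ^ r *
            (q * q * ((H₀ * q) ^ r * Real.exp (L * (q * (m + r / q)))))))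
          ≤ (c ^ (1 + 2 * m)) ^ r * ‖l‖⁻¹ ^ r * (r ^ r *
            ((((2 * m + 1) / (r / q)) ^ m) ^ r *
            ((4 * m) ^ r * ((H₀ * q) ^ r * Real.exp (L * (m + 1)) ^ r)))) := by gcongr
        _ = (E * (r * (q / r) ^ m * q)) ^ r := by
          have : (2 * m + 1) / ((r : ℝ) / q) = (2 * m + 1) * (q / r) := by field_simp
          simp only [← mul_pow]
          rw [hE, this, mul_pow _ _ m]
          ring)
  have hone := one_le_norm_mul_house_pow hne σ
  rw [hg, Nat.add_sub_cancel] at hone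
  have hbase : 1 ≤ (E * (r * (q / r) ^ m * q) * (D * (q * q)) ^ g) ^ r := by
    refine hone.trans ?_
    rw [mul_pow, pow_right_comm]
    exact mul_le_mul hnorm (pow_le_pow_left₀ (house_nonneg _) hhouse g)
      (pow_nonneg (house_nonneg _) _) (by positivity)
  have hbase' := (one_le_pow_iff_of_nonneg (by positivity) hr0).1 hbase
  have hfinal := gelfond_bound (Q := q) (r := r) (F := E * D ^ g) (u := 2 * m) (g := g)
    (by positivity) hrR (by positivity) hqq
    (hbase'.trans_eq (by rw [hm, mul_pow D]; ring))
  have : (s : ℝ) ≤ r := mod_cast hsr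
  linarith

end GelfondSchneider

theorem NumberField.exists_nat_mul_eq_ringOfIntegers {K : Type*} [Field K] [NumberField K]
    (u : K) : ∃ c : ℕ, 0 < c ∧ ∀ d : ℕ, ∃ x : 𝓞 K, (x : K) = (c * d : ℕ) * u := by
  obtain ⟨y, hy, hint⟩ := IsAlgebraic.exists_integral_multiple
    ((IsFractionRing.isAlgebraic_iff ℤ ℚ K).2 (Algebra.IsAlgebraic.isAlgebraic (R := ℚ) u))
  refine ⟨y.natAbs, Int.natAbs_pos.2 hy, fun d ↦ ?_⟩
  have h : IsIntegral ℤ ((y.natAbs * d : ℕ) * u) := by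
    have h1 : IsIntegral ℤ ((y.natAbs : K) * u) := by
      rcases Int.natAbs_eq y with h | h <;> rw [h, zsmul_eq_mul] at hint
      · simpa using hint
      · simpa using hint.neg
    have h2 := (isIntegral_algebraMap (R := ℤ) (A := K) (x := d)).mul h1
    rw [eq_intCast, Int.cast_natCast] at h2
    rwa [Nat.cast_mul, mul_comm (y.natAbs : K), mul_assoc]
  exact ⟨⟨_, h⟩, rfl⟩

/-- The **Gelfond–Schneider theorem**. -/
theorem transcendental_exp_mul_of_isAlgebraic {α l : ℂ} (hl : l ≠ 0) (hα : IsAlgebraic ℚ α)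
    (hirr : α ∉ Set.range ((↑) : ℚ → ℂ)) (hexp : IsAlgebraic ℚ (Complex.exp l)) :
    Transcendental ℚ (Complex.exp (α * l)) := by
  intro hγ
  let S : Set ℂ := {α, Complex.exp l, Complex.exp (α * l)}
  let K := IntermediateField.adjoin ℚ S
  have hfin : FiniteDimensional ℚ K := by
    refine IntermediateField.finiteDimensional_adjoin fun u hu ↦ ?_
    rcases hu with rfl | rfl | rfl
    exacts [hα.isIntegral, hexp.isIntegral, hγ.isIntegral]
  have : NumberField K := { to_charZero := inferInstance, to_finiteDimensional := hfin }
  have hmem : ∀ u ∈ S, u ∈ K := fun u hu ↦ IntermediateField.subset_adjoin ℚ S hu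
  let a : K := ⟨α, hmem _ (by simp [S])⟩
  let b : K := ⟨_, hmem (Complex.exp l) (by simp [S])⟩
  let e : K := ⟨_, hmem (Complex.exp (α * l)) (by simp [S])⟩
  obtain ⟨c₁, hc₁, hx⟩ := NumberField.exists_nat_mul_eq_ringOfIntegers a
  obtain ⟨c₂, hc₂, hy⟩ := NumberField.exists_nat_mul_eq_ringOfIntegers b
  obtain ⟨c₃, hc₃, hz⟩ := NumberField.exists_nat_mul_eq_ringOfIntegers e
  obtain ⟨x, hx⟩ := hx (c₂ * c₃)
  obtain ⟨y, hy⟩ := hy (c₁ * c₃)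
  obtain ⟨z, hz⟩ := hz (c₁ * c₂)
  obtain ⟨c, hc⟩ : ∃ c, c = c₁ * (c₂ * c₃) := ⟨_, rfl⟩
  rw [show c₂ * (c₁ * c₃) = c by rw [hc]; ring] at hy
  rw [show c₃ * (c₁ * c₂) = c by rw [hc]; ring] at hz
  rw [← hc] at hx
  have hc0 : 0 < c := by rw [hc]; positivity
  have hcC : (c : ℂ) ≠ 0 := by exact_mod_cast hc0.ne'
  have hdiv : ∀ {u : K} {v : 𝓞 K}, (v : K) = c * u → K.val.toRingHom v / c = (u : ℂ) := by
    intro u v h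
    rw [h]
    simp [hcC]
  refine gelfond_contradiction (σ := K.val.toRingHom) hc0 hl (hdiv hy).symm
    ((congrArg (fun w ↦ Complex.exp (w * l)) (hdiv hx)).trans (hdiv hz).symm) fun p p' hp ↦ ?_
  have h1 : ((p.1 : ℂ) - p'.1) + ((p.2 : ℂ) - p'.2) * α = 0 := by
    have h := congrArg (fun v : 𝓞 K ↦ K.val.toRingHom v / c) hp
    have hxC : K.val.toRingHom x = c * α := by
      rw [mul_comm]
      exact (div_eq_iff hcC).1 (hdiv hx)
    simp only [map_add, map_mul, map_natCast, hxC] at h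
    field_simp at h
    linear_combination h
  have h2 : p.2 = p'.2 := by
    by_contra hne
    refine hirr ⟨((p'.1 : ℚ) - p.1) / (p.2 - p'.2), ?_⟩
    have : (p.2 : ℂ) - p'.2 ≠ 0 := sub_ne_zero.2 (by exact_mod_cast hne)
    push_cast
    rw [div_eq_iff this]
    linear_combination -h1
  have h3 : p.1 = p'.1 := by
    rw [h2] at h1
    have : (p.1 : ℂ) = p'.1 := by linear_combination h1
    exact_mod_cast this
  exact Prod.ext h3 h2

theorem mobius_randomness_stmt3
    (α : ℝ) (hirr : Irrational α) (halg : IsAlgebraic ℚ (e2pi α)) :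
    Transcendental ℚ α := by
  intro hα
  refine transcendental_exp_mul_of_isAlgebraic (α := α) (l := 2 * Real.pi * Complex.I)
    Complex.two_pi_I_ne_zero hα.algebraMap (fun ⟨w, hw⟩ ↦ hirr ⟨w, ?_⟩) ?_ ?_
  · exact_mod_cast hw
  · rw [Complex.exp_two_pi_mul_I]
    exact isAlgebraic_one
  · rwa [mul_comm]
end

section
/- Let α be an irrational real algebraic number and let ε > 0. Then there exists a constant c > 0, depending only on α and ε, such that for every integer N ≥ 2 there exist integers r and s with 0 < |α − r/s| ≤ 1/(sN), 1 ≤ s ≤ N, gcd(r,s) = 1, and s > (c·N)^{1/(1+ε)}. -/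
open MvPolynomial

namespace Roth

section Taylor

variable {σ R S : Type*} [Fintype σ] [CommRing R] [CommRing S]

/-- The substitution `X ↦ X + a` in several variables. -/
noncomputable def taylor (a : σ → R) : MvPolynomial σ R →ₐ[R] MvPolynomial σ R :=
  aeval fun h => X h + C (a h)

/-- The product of the binomial coefficients `(e h).choose (i h)`. -/
def mchoose (e i : σ →₀ ℕ) : ℕ := ∏ h, (e h).choose (i h)

omit [Fintype σ] in
@[simp] lemma taylor_X (a : σ → R) (h : σ) : taylor a (X h) = X h + C (a h) := by
  simp [taylor]

omit [Fintype σ] in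
lemma taylor_taylor (a b : σ → R) (P : MvPolynomial σ R) :
    taylor a (taylor b P) = taylor (a + b) P := by
  have : (taylor a).comp (taylor b) = taylor (a + b) := by
    ext h : 1
    simp [taylor, add_assoc]
  exact DFunLike.congr_fun this P

omit [Fintype σ] in
lemma taylor_zero (P : MvPolynomial σ R) : taylor 0 P = P := by
  have : taylor (0 : σ → R) = AlgHom.id R _ := by
    ext h : 1
    simp [taylor]
  exact DFunLike.congr_fun this P

omit [Fintype σ] in
lemma taylor_injective (a : σ → R) : Function.Injective (taylor a) := fun P Q h => by
  have := congr_arg (taylor (-a)) h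
  simpa [taylor_taylor, taylor_zero] using this

omit [Fintype σ] in
lemma map_taylor (f : R →+* S) (a : σ → R) (P : MvPolynomial σ R) :
    map f (taylor a P) = taylor (f ∘ a) (map f P) := by
  induction P using MvPolynomial.induction_on with
  | C c => simp [taylor]
  | add p q hp hq => simp [hp, hq]
  | mul_X p h hp => simp [hp]

lemma mchoose_eq_zero {e i : σ →₀ ℕ} (h : ¬ i ≤ e) : mchoose e i = 0 := by
  obtain ⟨h, hh⟩ := not_forall.1 h
  exact Finset.prod_eq_zero (Finset.mem_univ h) (Nat.choose_eq_zero_of_lt (not_le.1 hh))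

lemma mchoose_le (e i : σ →₀ ℕ) : mchoose e i ≤ 2 ^ ∑ h, e h := by
  rw [← Finset.prod_pow_eq_pow_sum]
  exact Finset.prod_le_prod' fun h _ => Nat.choose_le_two_pow _ _

lemma coeff_taylor_monomial (a : σ → R) (i e : σ →₀ ℕ) (c : R) :
    coeff i (taylor a (monomial e c)) = c * mchoose e i * ∏ h, a h ^ (e h - i h) := by
  classical
  have h1 : taylor a (monomial e c) = C c * ∏ h, (X h + C (a h)) ^ e h := by
    rw [taylor, aeval_monomial, Finsupp.prod_fintype _ _ (by simp)]
    rfl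
  have h2 : ∏ h, (X h + C (a h) : MvPolynomial σ R) ^ e h =
      ∑ k ∈ Fintype.piFinset fun h => Finset.range (e h + 1),
        monomial (Finsupp.equivFunOnFinite.symm k)
          (∏ h, (a h ^ (e h - k h) * ((e h).choose (k h) : R))) := by
    simp_rw [add_pow]
    rw [Finset.prod_univ_sum]
    refine Finset.sum_congr rfl fun k _ => ?_
    rw [monomial_eq, Finsupp.prod_fintype _ _ (by simp), map_prod, ← Finset.prod_mul_distrib]
    refine Finset.prod_congr rfl fun h _ => ?_
    simp
    ring
  rw [h1, h2, coeff_C_mul, coeff_sum]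
  simp_rw [coeff_monomial]
  by_cases hi : i ≤ e
  · rw [Finset.sum_eq_single (i : σ → ℕ)]
    · rw [if_pos (by ext; simp), Finset.prod_mul_distrib, mchoose, Nat.cast_prod,
      mul_assoc, mul_comm (∏ h, a h ^ (e h - i h))]
    · intro k _ hk
      rw [if_neg]
      rintro rfl
      exact hk (by ext; simp)
    · intro hk
      refine absurd ?_ hk
      simp only [Fintype.mem_piFinset, Finset.mem_range]
      exact fun h => Nat.lt_succ_of_le (hi h)
  · rw [Finset.sum_eq_zero, mchoose_eq_zero hi]
    · simp
    · intro k hk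
      rw [if_neg]
      rintro rfl
      refine hi fun h => ?_
      simp only [Fintype.mem_piFinset, Finset.mem_range] at hk
      exact Nat.le_of_lt_succ (hk h)

lemma coeff_taylor (a : σ → R) (i : σ →₀ ℕ) (P : MvPolynomial σ R) :
    coeff i (taylor a P) =
      ∑ e ∈ P.support, coeff e P * mchoose e i * ∏ h, a h ^ (e h - i h) := by
  conv_lhs => rw [P.as_sum, map_sum, coeff_sum]
  exact Finset.sum_congr rfl fun e _ => coeff_taylor_monomial a i e _

/-- The divided (Hasse) derivative of multi-index `i`. -/
noncomputable def hasse (i : σ →₀ ℕ) (P : MvPolynomial σ R) : MvPolynomial σ R :=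
  coeff i (taylor X (map C P))

lemma hasse_eq (i : σ →₀ ℕ) (P : MvPolynomial σ R) :
    hasse i P = ∑ e ∈ P.support, monomial (e - i) (coeff e P * mchoose e i) := by
  rw [hasse, coeff_taylor, support_map_of_injective _ (C_injective σ R)]
  refine Finset.sum_congr rfl fun e _ => ?_
  rw [coeff_map, monomial_eq, Finsupp.prod_fintype _ _ (by simp)]
  simp

omit [Fintype σ] in
lemma hasse_sum {ι : Type*} (s : Finset ι) (i : σ →₀ ℕ) (P : ι → MvPolynomial σ R) :
    hasse i (∑ j ∈ s, P j) = ∑ j ∈ s, hasse i (P j) := by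
  simp [hasse, coeff_sum]

omit [Fintype σ] in
lemma hasse_smul (i : σ →₀ ℕ) (c : R) (P : MvPolynomial σ R) :
    hasse i (c • P) = c • hasse i P := by
  simp [hasse, smul_eq_C_mul]

lemma coeff_hasse (i j : σ →₀ ℕ) (P : MvPolynomial σ R) :
    coeff j (hasse i P) = mchoose (j + i) i * coeff (j + i) P := by
  classical
  rw [hasse_eq, coeff_sum]
  simp_rw [coeff_monomial]
  rw [Finset.sum_eq_single (j + i)]
  · simp [mul_comm]
  · intro e _ he
    split_ifs with h
    · rw [mchoose_eq_zero, Nat.cast_zero, mul_zero]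
      intro hie
      exact he (by rw [← h, tsub_add_cancel_of_le hie])
    · rfl
  · intro h
    simp [notMem_support_iff.1 h]

lemma map_hasse (f : R →+* S) (i : σ →₀ ℕ) (P : MvPolynomial σ R) :
    map f (hasse i P) = hasse i (map f P) := by
  ext j
  rw [coeff_map, coeff_hasse, coeff_hasse, coeff_map, map_mul, map_natCast]

omit [Fintype σ] in
lemma hasse_taylor (a : σ → R) (i : σ →₀ ℕ) (P : MvPolynomial σ R) :
    hasse i (taylor a P) = taylor a (hasse i P) := by
  have h (Q : MvPolynomial σ R) : taylor X (map C (taylor a Q)) =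
      map (taylor a).toRingHom (taylor X (map C Q)) := by
    rw [map_taylor, map_taylor, map_map]
    have hc : (taylor a).toRingHom.comp C = (C : R →+* MvPolynomial σ R) := by
      ext; simp [taylor]
    rw [hc, taylor_taylor]
    congr 2
    ext h
    simp
  rw [hasse, h, coeff_map]
  rfl

end Taylor

section SupportBound

variable {σ R S : Type*} [CommRing R] [CommRing S]

/-- All monomials of `P` have weight at least `c` with respect to `f`. -/
def SuppGE (f : (σ →₀ ℕ) →+ ℝ) (c : ℝ) (P : MvPolynomial σ R) : Prop :=
  ∀ e, coeff e P ≠ 0 → c ≤ f e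

variable {f : (σ →₀ ℕ) →+ ℝ} {c d : ℝ} {P Q : MvPolynomial σ R}

lemma SuppGE.mono (h : SuppGE f c P) (hd : d ≤ c) : SuppGE f d P :=
  fun e he => hd.trans (h e he)

lemma SuppGE.mul (hP : SuppGE f c P) (hQ : SuppGE f d Q) : SuppGE f (c + d) (P * Q) := by
  classical
  intro e he
  rw [coeff_mul] at he
  obtain ⟨⟨x, y⟩, hxy, hne⟩ := Finset.exists_ne_zero_of_sum_ne_zero he
  rw [Finset.HasAntidiagonal.mem_antidiagonal] at hxy
  rw [← hxy, map_add]
  exact add_le_add (hP x (left_ne_zero_of_mul hne)) (hQ y (right_ne_zero_of_mul hne))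

lemma SuppGE.one : SuppGE f 0 (1 : MvPolynomial σ R) := by
  classical
  intro e he
  rw [coeff_one] at he
  obtain rfl : 0 = e := by by_contra h; simp [h] at he
  simp

lemma SuppGE.prod {ι : Type*} (s : Finset ι) {P : ι → MvPolynomial σ R} {t : ι → ℝ}
    (h : ∀ j ∈ s, SuppGE f (t j) (P j)) : SuppGE f (∑ j ∈ s, t j) (∏ j ∈ s, P j) := by
  classical
  induction s using Finset.induction_on with
  | empty => simpa using SuppGE.one
  | insert a s ha ih =>
    rw [Finset.sum_insert ha, Finset.prod_insert ha]
    exact (h a (by simp)).mul (ih fun j hj => h j (by simp [hj]))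

lemma SuppGE.det {κ : Type*} [Fintype κ] [DecidableEq κ] {M : Matrix κ κ (MvPolynomial σ R)}
    {t : κ → ℝ} (h : ∀ i j, SuppGE f (t j) (M i j)) : SuppGE f (∑ j, t j) M.det := by
  intro e he
  rw [Matrix.det_apply, coeff_sum] at he
  obtain ⟨g, -, hg⟩ := Finset.exists_ne_zero_of_sum_ne_zero he
  refine SuppGE.prod Finset.univ (fun j _ => h (g j) j) e fun h0 => hg ?_
  rcases Int.units_eq_one_or (Equiv.Perm.sign g) with h1 | h1 <;> simp [h1, h0]

lemma SuppGE.map (hP : SuppGE f c P) (φ : R →+* S) : SuppGE f c (MvPolynomial.map φ P) := by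
  intro e he
  refine hP e fun h => he ?_
  rw [coeff_map, h, map_zero]

lemma SuppGE.hasse [Fintype σ] (hP : SuppGE f c P) (i : σ →₀ ℕ) :
    SuppGE f (c - f i) (Roth.hasse i P) := by
  intro e he
  rw [coeff_hasse] at he
  have := hP _ (right_ne_zero_of_mul he)
  rw [map_add] at this
  linarith

/-- The weight `-e h`, used to bound the degree in the variable `h`. -/
noncomputable def negDeg (h : σ) : (σ →₀ ℕ) →+ ℝ :=
  -((Nat.castAddMonoidHom ℝ).comp (Finsupp.applyAddHom h))

@[simp] lemma negDeg_apply (h : σ) (e : σ →₀ ℕ) : negDeg h e = -(e h : ℝ) := rfl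

/-- The weight `∑ h, e h / r h` defining the index. -/
noncomputable def wt [Fintype σ] (r : σ → ℕ) : (σ →₀ ℕ) →+ ℝ where
  toFun e := ∑ h, (e h : ℝ) / r h
  map_zero' := by simp
  map_add' x y := by simp [add_div, Finset.sum_add_distrib]

lemma wt_apply [Fintype σ] (r : σ → ℕ) (e : σ →₀ ℕ) : wt r e = ∑ h, (e h : ℝ) / r h := rfl

lemma wt_nonneg [Fintype σ] (r : σ → ℕ) (e : σ →₀ ℕ) : 0 ≤ wt r e :=
  Finset.sum_nonneg fun h _ => by positivity

end SupportBound

section CoefficientNorm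

variable {σ R : Type*} [NormedCommRing R]

/-- The sum of the norms of the coefficients. -/
noncomputable def l1 (P : MvPolynomial σ R) : ℝ := ∑ e ∈ P.support, ‖coeff e P‖

lemma l1_nonneg (P : MvPolynomial σ R) : 0 ≤ l1 P := Finset.sum_nonneg fun _ _ => norm_nonneg _

lemma l1_eq_sum {P : MvPolynomial σ R} {s : Finset (σ →₀ ℕ)} (h : P.support ⊆ s) :
    l1 P = ∑ e ∈ s, ‖coeff e P‖ :=
  Finset.sum_subset h fun e _ he => by simp [notMem_support_iff.1 he]

lemma norm_coeff_le_l1 (P : MvPolynomial σ R) (e : σ →₀ ℕ) : ‖coeff e P‖ ≤ l1 P := by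
  by_cases h : e ∈ P.support
  · exact Finset.single_le_sum (f := fun e => ‖coeff e P‖) (fun _ _ => norm_nonneg _) h
  · simpa [notMem_support_iff.1 h] using l1_nonneg P

@[simp] lemma l1_zero : l1 (0 : MvPolynomial σ R) = 0 := by simp [l1]

lemma l1_add_le (P Q : MvPolynomial σ R) : l1 (P + Q) ≤ l1 P + l1 Q := by
  classical
  rw [l1_eq_sum (support_add (p := P) (q := Q)),
    l1_eq_sum (Finset.subset_union_left (s₁ := P.support) (s₂ := Q.support)),
    l1_eq_sum (Finset.subset_union_right (s₁ := P.support) (s₂ := Q.support)),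
    ← Finset.sum_add_distrib]
  exact Finset.sum_le_sum fun e _ => by simpa using norm_add_le _ _

lemma l1_sum_le {ι : Type*} (s : Finset ι) (P : ι → MvPolynomial σ R) :
    l1 (∑ j ∈ s, P j) ≤ ∑ j ∈ s, l1 (P j) :=
  Finset.le_sum_of_subadditive _ l1_zero.le l1_add_le _ _

@[simp] lemma l1_neg (P : MvPolynomial σ R) : l1 (-P) = l1 P := by simp [l1]

@[simp] lemma l1_monomial (e : σ →₀ ℕ) (c : R) : l1 (monomial e c) = ‖c‖ := by
  classical
  rw [l1_eq_sum (support_monomial_subset (s := e) (a := c))]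
  simp

lemma l1_mul_le (P Q : MvPolynomial σ R) : l1 (P * Q) ≤ l1 P * l1 Q := by
  conv_lhs => rw [P.as_sum, Q.as_sum, Finset.sum_mul_sum]
  refine (l1_sum_le _ _).trans ?_
  rw [l1, l1, Finset.sum_mul_sum]
  refine Finset.sum_le_sum fun e _ => (l1_sum_le _ _).trans (Finset.sum_le_sum fun e' _ => ?_)
  rw [monomial_mul, l1_monomial]
  exact norm_mul_le _ _

lemma l1_prod_le [NormOneClass R] {ι : Type*} (s : Finset ι) (P : ι → MvPolynomial σ R) :
    l1 (∏ j ∈ s, P j) ≤ ∏ j ∈ s, l1 (P j) := by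
  classical
  induction s using Finset.induction_on with
  | empty =>
    have := l1_monomial (0 : σ →₀ ℕ) (1 : R)
    simp only [Finset.prod_empty]
    rw [← C_1, C_apply, this, norm_one]
  | insert a s ha ih =>
    rw [Finset.prod_insert ha, Finset.prod_insert ha]
    exact (l1_mul_le _ _).trans (mul_le_mul_of_nonneg_left ih (l1_nonneg _))

lemma l1_det_le [NormOneClass R] {k : ℕ} {M : Matrix (Fin k) (Fin k) (MvPolynomial σ R)} {B : ℝ}
    (h : ∀ i j, l1 (M i j) ≤ B) : l1 M.det ≤ k.factorial * B ^ k := by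
  rw [Matrix.det_apply]
  refine (l1_sum_le _ _).trans ?_
  have (g : Equiv.Perm (Fin k)) : l1 (Equiv.Perm.sign g • ∏ i, M (g i) i) ≤ B ^ k := by
    have h2 : l1 (∏ i, M (g i) i) ≤ B ^ k := by
      refine (l1_prod_le _ _).trans ?_
      refine (Finset.prod_le_prod (fun _ _ => l1_nonneg _) fun i _ => h (g i) i).trans ?_
      simp
    rcases Int.units_eq_one_or (Equiv.Perm.sign g) with h1 | h1 <;> simpa [h1] using h2
  refine (Finset.sum_le_sum fun g _ => this g).trans ?_
  simp [Fintype.card_perm]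

lemma l1_hasse_le [Fintype σ] [NormOneClass R] {P : MvPolynomial σ R} {D : ℕ}
    (h : ∀ e, coeff e P ≠ 0 → ∑ k, e k ≤ D) (i : σ →₀ ℕ) : l1 (hasse i P) ≤ 2 ^ D * l1 P := by
  rw [hasse_eq, show l1 P = ∑ e ∈ P.support, ‖coeff e P‖ from rfl, Finset.mul_sum]
  refine (l1_sum_le _ _).trans (Finset.sum_le_sum fun e he => ?_)
  rw [l1_monomial, mul_comm (2 ^ D : ℝ)]
  refine (norm_mul_le _ _).trans (mul_le_mul_of_nonneg_left ?_ (norm_nonneg _))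
  refine (Nat.norm_cast_le _).trans ?_
  rw [norm_one, mul_one]
  have := (mchoose_le e i).trans (Nat.pow_le_pow_right two_pos (h e (mem_support_iff.1 he)))
  exact_mod_cast this

end CoefficientNorm

section Wronskian

lemma exists_det_ne_zero {A K : Type*} [Field K] {k : ℕ} (v : A → Fin k → K)
    (h : ∀ c : Fin k → K, (∀ a, ∑ j, c j * v a j = 0) → c = 0) :
    ∃ a : Fin k → A, (Matrix.of fun i => v (a i)).det ≠ 0 := by
  classical
  have hspan : Submodule.span K (Set.range v) = ⊤ := by
    by_contra hne
    obtain ⟨f, hf0, hf⟩ := Submodule.exists_le_ker_of_lt_top _ (lt_top_iff_ne_top.2 hne)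
    have hc := h (fun j => f fun i => if j = i then 1 else 0) fun a => by
      have h1 : f (v a) = 0 := hf (Submodule.subset_span ⟨a, rfl⟩)
      rw [LinearMap.pi_apply_eq_sum_univ] at h1
      simpa [mul_comm] using h1
    refine hf0 (LinearMap.ext fun x => ?_)
    rw [LinearMap.pi_apply_eq_sum_univ]
    exact Finset.sum_eq_zero fun j _ => by rw [congr_fun hc j]; simp
  obtain ⟨κ, a, -, hsp, hli⟩ := exists_linearIndependent' K v
  let b : Module.Basis κ K (Fin k → K) := Module.Basis.mk hli (by rw [hsp, hspan])
  let e : Fin k ≃ κ := (Pi.basisFun K (Fin k)).indexEquiv b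
  refine ⟨a ∘ e, ?_⟩
  have : LinearIndependent K (Matrix.of fun i => v ((a ∘ e) i)).row := hli.comp e e.injective
  rw [Matrix.linearIndependent_rows_iff_isUnit, Matrix.isUnit_iff_isUnit_det] at this
  exact this.ne_zero

variable {σ : Type*} [Fintype σ]

/-- The functions on multi-indices spanned by binomial products of order at most `d`. -/
noncomputable def binomialSpan (σ : Type*) [Fintype σ] (d : ℕ) :
    Submodule ℚ ((σ →₀ ℕ) → ℚ) :=
  Submodule.span ℚ {f | ∃ a : σ →₀ ℕ, ∑ h, a h ≤ d ∧ f = fun x => (mchoose x a : ℚ)}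

lemma coord_mul_mchoose (x a : σ →₀ ℕ) (h : σ) :
    (x h : ℚ) * mchoose x a =
      (a h + 1) * mchoose x (a + Finsupp.single h 1) + a h * mchoose x a := by
  classical
  have hsplit (b : σ →₀ ℕ) :
      mchoose x b = (x h).choose (b h) * ∏ i ∈ Finset.univ.erase h, (x i).choose (b i) :=
    (Finset.mul_prod_erase _ _ (Finset.mem_univ h)).symm
  have herase : ∏ i ∈ Finset.univ.erase h, (x i).choose ((a + Finsupp.single h 1 : σ →₀ ℕ) i) =
      ∏ i ∈ Finset.univ.erase h, (x i).choose (a i) :=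
    Finset.prod_congr rfl fun i hi => by
      simp [Finsupp.single_eq_of_ne (Finset.ne_of_mem_erase hi)]
  rw [hsplit a, hsplit (a + Finsupp.single h 1), herase]
  have key : (x h : ℚ) * (x h).choose (a h) =
      (a h + 1) * (x h).choose (a h + 1) + a h * (x h).choose (a h) := by
    rcases le_or_gt (a h) (x h) with hle | hlt
    · have := Nat.choose_succ_right_eq (x h) (a h)
      have h2 : ((x h).choose (a h + 1) : ℚ) * (a h + 1) = (x h).choose (a h) * (x h - a h) := by
        rw [← Nat.cast_sub hle]
        exact_mod_cast this
      linarith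
    · simp [Nat.choose_eq_zero_of_lt hlt, Nat.choose_eq_zero_of_lt (hlt.trans (Nat.lt_succ_self _))]
  simp only [Finsupp.add_apply, Finsupp.single_eq_same, Nat.cast_mul]
  rw [← mul_assoc, key]
  ring

lemma coord_sub_mul_mem_binomialSpan {d : ℕ} {f : (σ →₀ ℕ) → ℚ} (hf : f ∈ binomialSpan σ d)
    (h : σ) (c : ℚ) : (fun x => ((x h : ℚ) - c) * f x) ∈ binomialSpan σ (d + 1) := by
  classical
  induction hf using Submodule.span_induction with
  | mem f hf =>
    obtain ⟨a, ha, rfl⟩ := hf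
    have h1 : (fun x : σ →₀ ℕ => ((x h : ℚ) - c) * mchoose x a) =
        ((a h : ℚ) + 1) • (fun x => (mchoose x (a + Finsupp.single h 1) : ℚ)) +
          ((a h : ℚ) - c) • fun x => (mchoose x a : ℚ) := by
      ext x
      simp only [Pi.add_apply, Pi.smul_apply, smul_eq_mul]
      linear_combination coord_mul_mchoose x a h
    rw [h1]
    refine add_mem (Submodule.smul_mem _ _ (Submodule.subset_span ⟨_, ?_, rfl⟩))
      (Submodule.smul_mem _ _ (Submodule.subset_span ⟨a, ha.trans (Nat.le_succ d), rfl⟩))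
    simp only [Finsupp.add_apply, Finset.sum_add_distrib, Finsupp.single_apply]
    simpa using ha
  | zero =>
    convert (binomialSpan σ (d + 1)).zero_mem using 1
    ext x
    simp
  | add f g _ _ hf hg =>
    convert add_mem hf hg using 1
    ext x
    simp [mul_add]
  | smul r f _ hf =>
    convert Submodule.smul_mem _ r hf using 1
    ext x
    simp
    ring

lemma prod_coord_sub_mem_binomialSpan {ι : Type*} (s : Finset ι) (h : ι → σ) (c : ι → ℚ) :
    (fun x : σ →₀ ℕ => ∏ j ∈ s, ((x (h j) : ℚ) - c j)) ∈ binomialSpan σ s.card := by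
  classical
  induction s using Finset.induction_on with
  | empty =>
    refine Submodule.subset_span ⟨0, by simp, ?_⟩
    ext x
    simp [mchoose]
  | insert a s ha ih =>
    rw [Finset.card_insert_of_notMem ha]
    simpa only [Finset.prod_insert ha] using coord_sub_mul_mem_binomialSpan ih (h a) (c a)

lemma exists_mchoose_det_ne_zero {k : ℕ} {e : Fin k → σ →₀ ℕ} (he : Function.Injective e) :
    ∃ a : Fin k → σ →₀ ℕ, (∀ i, ∑ h, a i h < k) ∧
      (Matrix.of fun i j => (mchoose (e j) (a i) : ℚ)).det ≠ 0 := by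
  classical
  obtain ⟨a, ha⟩ := exists_det_ne_zero
    (fun (a : {a : σ →₀ ℕ // ∑ h, a h < k}) j => (mchoose (e j) a.1 : ℚ)) (by
      intro c hc
      have hspan : ∀ g ∈ binomialSpan σ (k - 1), ∑ j, c j * g (e j) = 0 := by
        intro g hg
        induction hg using Submodule.span_induction with
        | mem g hg =>
          obtain ⟨a, ha, rfl⟩ := hg
          rcases Nat.eq_zero_or_pos k with rfl | hk
          · simp
          · exact hc ⟨a, by omega⟩
        | zero => simp
        | add f g _ _ hf hg => simp [mul_add, Finset.sum_add_distrib, hf, hg]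
        | smul r f _ hf =>
          simp only [Pi.smul_apply, smul_eq_mul, mul_left_comm _ r, ← Finset.mul_sum, hf, mul_zero]
      ext j₀
      have hne (j : {j // j ≠ j₀}) : ∃ h : σ, e j₀ h ≠ e j.1 h :=
        DFunLike.ne_iff.1 (he.ne j.2.symm)
      choose h hh using hne
      have hcard : (Finset.univ : Finset {j // j ≠ j₀}).card = k - 1 := by simp
      have hg := hspan _ (hcard ▸ prod_coord_sub_mem_binomialSpan Finset.univ h
        fun j => (e j.1 (h j) : ℚ))
      rw [Finset.sum_eq_single j₀] at hg
      · refine (mul_eq_zero.1 hg).resolve_right (Finset.prod_ne_zero_iff.2 fun j _ => ?_)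
        exact sub_ne_zero.2 (Nat.cast_injective.ne (hh j))
      · intro j _ hj
        rw [Finset.prod_eq_zero (Finset.mem_univ (⟨j, hj⟩ : {j // j ≠ j₀})) (sub_self _), mul_zero]
      · simp)
  exact ⟨fun i => (a i).1, fun i => (a i).2, ha⟩

lemma exists_injective_degree {n k : ℕ} (m : MonomialOrder (Fin n))
    {φ : Fin k → MvPolynomial (Fin n) ℚ} (hφ : LinearIndependent ℚ φ) :
    ∃ f : Fin k → MvPolynomial (Fin n) ℚ, (∀ j, f j ∈ Submodule.span ℚ (Set.range φ)) ∧
      (∀ j, f j ≠ 0) ∧ Function.Injective fun j => m.degree (f j) := by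
  classical
  set V := Submodule.span ℚ (Set.range φ)
  let L : Set (Fin n →₀ ℕ) := {e | ∃ f ∈ V, f ≠ 0 ∧ m.degree f = e}
  have hL : (k : ℕ∞) ≤ L.encard := by
    by_contra hlt
    rw [not_le] at hlt
    have hfin : L.Finite := Set.finite_of_encard_le_coe hlt.le
    have := hfin.fintype
    let T : V →ₗ[ℚ] (L → ℚ) := LinearMap.pi fun e => (lcoeff ℚ e.1).comp V.subtype
    have hT : Function.Injective T := by
      rw [← LinearMap.ker_eq_bot, LinearMap.ker_eq_bot']
      intro f hf
      by_contra hne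
      have hne' : (f : MvPolynomial (Fin n) ℚ) ≠ 0 := fun h => hne (Subtype.ext h)
      exact (m.coeff_degree_ne_zero_iff.2 hne') (congr_fun hf ⟨_, f.1, f.2, hne', rfl⟩)
    have h1 := LinearMap.finrank_le_finrank_of_injective hT
    rw [finrank_span_eq_card hφ, Module.finrank_fintype_fun_eq_card, Fintype.card_fin] at h1
    rw [← Set.coe_fintypeCard] at hlt
    exact absurd hlt (not_lt.2 (by exact_mod_cast h1))
  obtain ⟨t, htL, ht⟩ := Set.exists_subset_encard_eq hL
  have htf : t.Finite := Set.finite_of_encard_eq_coe ht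
  have := htf.fintype
  rw [← Set.coe_fintypeCard] at ht
  let e : Fin k ≃ t := (Fintype.equivFinOfCardEq (by exact_mod_cast ht)).symm
  choose f hfV hf0 hfd using fun j : Fin k => htL (e j).2
  exact ⟨f, hfV, hf0, fun i j hij => e.injective (Subtype.ext (by simpa [hfd] using hij))⟩

lemma coeff_prod_of_degree_le {τ ι R : Type*} [CommRing R] (m : MonomialOrder τ) (s : Finset ι)
    {P : ι → MvPolynomial τ R} {e : ι → τ →₀ ℕ}
    (h : ∀ i ∈ s, m.toSyn (m.degree (P i)) ≤ m.toSyn (e i)) :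
    m.toSyn (m.degree (∏ i ∈ s, P i)) ≤ m.toSyn (∑ i ∈ s, e i) ∧
      coeff (∑ i ∈ s, e i) (∏ i ∈ s, P i) = ∏ i ∈ s, coeff (e i) (P i) := by
  classical
  induction s using Finset.induction_on with
  | empty => simp
  | insert a s ha ih =>
    obtain ⟨h1, h2⟩ := ih fun i hi => h i (by simp [hi])
    have h3 := h a (by simp)
    rw [Finset.prod_insert ha, Finset.sum_insert ha, Finset.prod_insert ha]
    refine ⟨m.degree_mul_le.trans ?_, ?_⟩
    · rw [map_add, map_add]
      exact add_le_add h3 h1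
    · rw [m.coeff_mul_of_add_of_degree_le h3 h1, h2]

/-- Nonvanishing of a generalized Wronskian of linearly independent polynomials. -/
theorem exists_hasse_det_ne_zero {n k : ℕ} {φ : Fin k → MvPolynomial (Fin n) ℚ}
    (hφ : LinearIndependent ℚ φ) :
    ∃ a : Fin k → Fin n →₀ ℕ, (∀ i, ∑ h, a i h < k) ∧
      (Matrix.of fun i j => hasse (a i) (φ j)).det ≠ 0 := by
  classical
  let m : MonomialOrder (Fin n) := MonomialOrder.lex
  obtain ⟨f, hfV, hf0, hinj⟩ := exists_injective_degree m hφ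
  obtain ⟨a, ha, hdet⟩ := exists_mchoose_det_ne_zero hinj
  refine ⟨a, ha, fun h0 => hdet ?_⟩
  choose c hc using fun j => (Submodule.mem_span_range_iff_exists_fun ℚ).1 (hfV j)
  have hmat : (Matrix.of fun i j => hasse (a i) (f j)) =
      (Matrix.of fun i j => hasse (a i) (φ j)) * Matrix.of fun l j => C (c j l) := by
    ext1 i j
    simp only [Matrix.mul_apply, Matrix.of_apply]
    rw [← hc j, hasse_sum]
    exact Finset.sum_congr rfl fun l _ => by rw [hasse_smul, smul_eq_C_mul, mul_comm]
  have hf : (Matrix.of fun i j => hasse (a i) (f j)).det = 0 := by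
    rw [hmat, Matrix.det_mul, h0, zero_mul]
  have hcoeff (i j : Fin k) (x : Fin n →₀ ℕ) :
      coeff x (monomial (a i) 1 * hasse (a i) (f j)) = mchoose x (a i) * coeff x (f j) := by
    rw [coeff_monomial_mul', one_mul]
    split_ifs with h
    · rw [coeff_hasse, tsub_add_cancel_of_le h]
    · rw [mchoose_eq_zero h, Nat.cast_zero, zero_mul]
  have hD : (Matrix.of fun i j => monomial (a i) 1 * hasse (a i) (f j)).det = 0 := by
    have := Matrix.det_mul_column (fun i => (monomial (a i) 1 : MvPolynomial (Fin n) ℚ))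
      (Matrix.of fun i j => hasse (a i) (f j))
    rw [hf, mul_zero] at this
    exact this
  have htop : coeff (∑ j, m.degree (f j))
      (Matrix.of fun i j => monomial (a i) 1 * hasse (a i) (f j)).det =
      (Matrix.of fun i j => m.leadingCoeff (f j) * (mchoose (m.degree (f j)) (a i) : ℚ)).det := by
    rw [Matrix.det_apply, Matrix.det_apply, coeff_sum]
    refine Finset.sum_congr rfl fun g _ => ?_
    have := (coeff_prod_of_degree_le m Finset.univ
      (P := fun j => monomial (a (g j)) 1 * hasse (a (g j)) (f j))
      (e := fun j => m.degree (f j)) fun j _ => m.degree_le_iff.2 fun x hx => m.le_degree ?_).2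
    · have h2 : coeff (∑ j, m.degree (f j)) (∏ j, monomial (a (g j)) 1 * hasse (a (g j)) (f j)) =
          ∏ j, m.leadingCoeff (f j) * (mchoose (m.degree (f j)) (a (g j)) : ℚ) := by
        rw [this]
        exact Finset.prod_congr rfl fun j _ => by rw [hcoeff, mul_comm]; rfl
      simp only [Matrix.of_apply]
      rw [← h2]
      rcases Int.units_eq_one_or (Equiv.Perm.sign g) with h1 | h1 <;> simp [h1]
    · rw [mem_support_iff, hcoeff] at hx
      exact mem_support_iff.2 (right_ne_zero_of_mul hx)
  rw [hD, coeff_zero] at htop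
  have hrow := Matrix.det_mul_row (fun j => m.leadingCoeff (f j))
    (Matrix.of fun i j => (mchoose (m.degree (f j)) (a i) : ℚ))
  have hprod : (∏ j, m.leadingCoeff (f j)) ≠ 0 :=
    Finset.prod_ne_zero_iff.2 fun j _ => m.leadingCoeff_ne_zero_iff.2 (hf0 j)
  exact (mul_eq_zero.1 (hrow.symm.trans htop.symm)).resolve_left hprod

end Wronskian

section HeadTail

variable {n : ℕ} {R : Type*} [CommRing R]

/-- Inclusion of the polynomials in the last `n` variables. -/
noncomputable def liftTail : MvPolynomial (Fin n) R →+* MvPolynomial (Fin (n + 1)) R :=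
  (finSuccEquiv R n).symm.toRingEquiv.toRingHom.comp Polynomial.C

/-- Inclusion of the polynomials in the variable `0`. -/
noncomputable def liftHead (n : ℕ) : Polynomial R →+* MvPolynomial (Fin (n + 1)) R :=
  (finSuccEquiv R n).symm.toRingEquiv.toRingHom.comp (Polynomial.mapRingHom C)

lemma finSuccEquiv_liftTail (φ : MvPolynomial (Fin n) R) :
    finSuccEquiv R n (liftTail φ) = Polynomial.C φ :=
  (finSuccEquiv R n).apply_symm_apply _

lemma finSuccEquiv_liftHead (ψ : Polynomial R) :
    finSuccEquiv R n (liftHead n ψ) = ψ.map C :=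
  (finSuccEquiv R n).apply_symm_apply _

lemma coeff_cons_lift (φ : MvPolynomial (Fin n) R) (ψ : Polynomial R) (b : ℕ) (a : Fin n →₀ ℕ) :
    coeff (a.cons b) (liftTail φ * liftHead n ψ) = coeff a φ * ψ.coeff b := by
  rw [← finSuccEquiv_coeff_coeff, map_mul, finSuccEquiv_liftTail, finSuccEquiv_liftHead,
    Polynomial.coeff_C_mul, Polynomial.coeff_map, mul_comm, coeff_C_mul, mul_comm]

lemma liftHead_injective : Function.Injective (liftHead n : Polynomial R → _) := fun p q h => by
  have := congr_arg (finSuccEquiv R n) h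
  rw [finSuccEquiv_liftHead, finSuccEquiv_liftHead] at this
  exact Polynomial.map_injective _ (C_injective _ _) this

lemma ext_cons {P Q : MvPolynomial (Fin (n + 1)) R}
    (h : ∀ b a, coeff (Finsupp.cons b a) P = coeff (Finsupp.cons b a) Q) : P = Q := by
  ext e
  rw [← Finsupp.cons_tail e]
  exact h _ _

lemma mchoose_cons (x y : ℕ) (e i : Fin n →₀ ℕ) :
    mchoose (e.cons x) (i.cons y) = x.choose y * mchoose e i := by
  simp [mchoose, Fin.prod_univ_succ]

lemma cons_add_cons (x y : ℕ) (e i : Fin n →₀ ℕ) :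
    e.cons x + i.cons y = (e + i).cons (x + y) := by
  ext h
  refine Fin.cases ?_ (fun j => ?_) h <;> simp

lemma hasse_cons_lift (b : ℕ) (a : Fin n →₀ ℕ) (φ : MvPolynomial (Fin n) R) (ψ : Polynomial R) :
    hasse (a.cons b) (liftTail φ * liftHead n ψ) =
      liftTail (hasse a φ) * liftHead n (Polynomial.hasseDeriv b ψ) := by
  refine ext_cons fun y i => ?_
  rw [coeff_hasse, cons_add_cons, mchoose_cons, coeff_cons_lift, coeff_cons_lift, coeff_hasse,
    Polynomial.hasseDeriv_coeff]
  push_cast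
  ring

lemma taylor_liftTail (a : Fin (n + 1) → R) (φ : MvPolynomial (Fin n) R) :
    taylor a (liftTail φ) = liftTail (taylor (Fin.tail a) φ) := by
  have hC (c : R) : (liftTail (C c) : MvPolynomial (Fin (n + 1)) R) = C c :=
    (finSuccEquiv R n).injective (by rw [finSuccEquiv_liftTail]; simp [finSuccEquiv_apply])
  have hX (j : Fin n) : (liftTail (X j) : MvPolynomial (Fin (n + 1)) R) = X j.succ :=
    (finSuccEquiv R n).injective (by rw [finSuccEquiv_liftTail, finSuccEquiv_X_succ])
  induction φ using MvPolynomial.induction_on with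
  | C c => rw [hC]; simp [taylor, hC]
  | add p q hp hq => simp [hp, hq]
  | mul_X p h hp => simp [hp, hX, hC, Fin.tail]

lemma taylor_liftHead (a : Fin (n + 1) → R) (ψ : Polynomial R) :
    taylor a (liftHead n ψ) = liftHead n (Polynomial.taylor (a 0) ψ) := by
  have hC (c : R) : (liftHead n (Polynomial.C c)) = C c :=
    (finSuccEquiv R n).injective (by rw [finSuccEquiv_liftHead]; simp [finSuccEquiv_apply])
  have hX : (liftHead n (Polynomial.X : Polynomial R)) = X 0 :=
    (finSuccEquiv R n).injective (by rw [finSuccEquiv_liftHead, finSuccEquiv_X_zero]; simp)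
  have h : (taylor a).toRingHom.comp (liftHead n) =
      (liftHead n).comp (Polynomial.taylorAlgHom (a 0)).toRingHom := by
    refine Polynomial.ringHom_ext (fun c => ?_) ?_
    · simp [hC, taylor]
    · simp [hX, hC]
  exact DFunLike.congr_fun h ψ

lemma exists_hasseDeriv_det_ne_zero {k : ℕ} {ψ : Fin k → Polynomial ℚ}
    (hψ : LinearIndependent ℚ ψ) :
    ∃ b : Fin k → ℕ, Function.Injective b ∧ (∀ i, b i < k) ∧
      (Matrix.of fun i j => Polynomial.hasseDeriv (b i) (ψ j)).det ≠ 0 := by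
  have hC (c : ℚ) (p : Polynomial ℚ) : liftHead 0 (c • p) = c • liftHead 0 p := by
    refine (finSuccEquiv ℚ 0).injective ?_
    rw [finSuccEquiv_liftHead, map_smul, finSuccEquiv_liftHead]
    ext
    simp
  let L : Polynomial ℚ →ₗ[ℚ] MvPolynomial (Fin 1) ℚ :=
    { toFun := liftHead 0, map_add' := map_add _, map_smul' := hC }
  have hL : LinearIndependent ℚ (L ∘ ψ) :=
    hψ.map' L (LinearMap.ker_eq_bot.2 liftHead_injective)
  obtain ⟨a, ha, hdet⟩ := exists_hasse_det_ne_zero hL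
  have hmat : (Matrix.of fun i j => hasse (a i) ((L ∘ ψ) j)) =
      (liftHead 0).mapMatrix (Matrix.of fun i j => Polynomial.hasseDeriv (a i 0) (ψ j)) := by
    ext1 i j
    have h1 := hasse_cons_lift (a i 0) 0 (1 : MvPolynomial (Fin 0) ℚ) (ψ j)
    have h2 : (0 : Fin 0 →₀ ℕ).cons (a i 0) = a i := by
      ext h; fin_cases h; simp
    have h3 : hasse 0 (1 : MvPolynomial (Fin 0) ℚ) = 1 := by
      ext e
      rw [coeff_hasse, Subsingleton.elim e 0]
      simp [mchoose]
    rw [h2, h3, map_one, one_mul, one_mul] at h1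
    exact h1
  rw [hmat, ← RingHom.map_det] at hdet
  have hdet' : (Matrix.of fun i j => Polynomial.hasseDeriv (a i 0) (ψ j)).det ≠ 0 :=
    fun h => hdet (by rw [h, map_zero])
  refine ⟨fun i => a i 0, fun i j hij => ?_, fun i => by simpa using ha i, hdet'⟩
  by_contra hne
  exact hdet' (Matrix.det_zero_of_row_eq hne (by
    ext1 l; simp only [Matrix.of_apply]; rw [show a i 0 = a j 0 from hij]))

lemma exists_decomposition (P : MvPolynomial (Fin (n + 1)) ℚ) (r : ℕ)
    (hP : ∀ e, coeff e P ≠ 0 → e 0 ≤ r) :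
    ∃ (k : ℕ) (φ : Fin k → MvPolynomial (Fin n) ℚ) (ψ : Fin k → Polynomial ℚ),
      k ≤ r + 1 ∧ LinearIndependent ℚ φ ∧ LinearIndependent ℚ ψ ∧
        P = ∑ j, liftTail (φ j) * liftHead n (ψ j) := by
  classical
  let c : Fin (r + 1) → MvPolynomial (Fin n) ℚ := fun l => (finSuccEquiv ℚ n P).coeff l
  let V := Submodule.span ℚ (Set.range c)
  have : Module.Finite ℚ V := Module.Finite.span_of_finite ℚ (Set.finite_range c)
  let b := Module.finBasis ℚ V
  let v : Fin (r + 1) → V := fun l => ⟨c l, Submodule.subset_span ⟨l, rfl⟩⟩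
  have hv : Submodule.span ℚ (Set.range v) = ⊤ := by
    have h1 : Set.range v = Subtype.val ⁻¹' Set.range c := by
      ext x
      simp [v, Subtype.ext_iff]
    rw [h1]
    exact Submodule.span_span_coe_preimage
  refine ⟨Module.finrank ℚ V, fun j => b j, fun j => ∑ l : Fin (r + 1), Polynomial.monomial l (b.repr (v l) j),
    ?_, ?_, ?_, ?_⟩
  · exact (finrank_range_le_card (R := ℚ) c).trans (by simp)
  · exact b.linearIndependent.map' V.subtype V.ker_subtype
  · rw [Fintype.linearIndependent_iff]
    intro g hg
    let f : V →ₗ[ℚ] ℚ := ∑ j, g j • b.coord j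
    have hf : f = 0 := by
      refine LinearMap.ext_on hv ?_
      rintro _ ⟨l, rfl⟩
      have := congr_arg (Polynomial.coeff · (l : ℕ)) hg
      simp only [Polynomial.finsetSum_coeff, Polynomial.coeff_smul, Polynomial.coeff_monomial,
        Fin.val_inj, Finset.sum_ite_eq', Finset.mem_univ, if_true, Polynomial.coeff_zero] at this
      simpa [f] using this
    intro j
    have := LinearMap.congr_fun hf (b j)
    simpa [f, Finsupp.single_apply] using this
  · refine ext_cons fun y a => ?_
    rw [coeff_sum]
    simp_rw [coeff_cons_lift, Polynomial.finsetSum_coeff, Polynomial.coeff_monomial]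
    by_cases hy : y ≤ r
    · have h1 (j) : (∑ l : Fin (r + 1), if (l : ℕ) = y then (b.repr (v l)) j else 0) =
          b.repr (v ⟨y, Nat.lt_succ_of_le hy⟩) j := by
        rw [Finset.sum_eq_single ⟨y, Nat.lt_succ_of_le hy⟩]
        · simp
        · intro l _ hl
          rw [if_neg fun h => hl (Fin.ext h)]
        · simp
      simp_rw [h1]
      have h2 := congr_arg (fun x : V => coeff a (x : MvPolynomial (Fin n) ℚ))
        (b.sum_repr (v ⟨y, Nat.lt_succ_of_le hy⟩))
      simp only [Submodule.coe_sum, Submodule.coe_smul, coeff_sum, coeff_smul, smul_eq_mul] at h2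
      rw [← finSuccEquiv_coeff_coeff]
      simp_rw [mul_comm (coeff a _)]
      exact h2.symm
    · have h0 : coeff (a.cons y) P = 0 := by
        by_contra h
        exact hy (by simpa using hP _ h)
      rw [h0, Finset.sum_eq_zero]
      intro j _
      rw [Finset.sum_eq_zero, mul_zero]
      intro l _
      rw [if_neg]
      have := l.2
      omega

end HeadTail

section RothLemma

lemma isPrimitive_den_mul_X_sub_num (x : ℚ) :
    (Polynomial.C (x.den : ℤ) * Polynomial.X - Polynomial.C x.num).IsPrimitive := by
  intro c hc
  rw [Polynomial.C_dvd_iff_dvd_coeff] at hc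
  have h0 : c ∣ x.num := by simpa using hc 0
  have h1 : c ∣ x.den := by
    have := hc 1
    rwa [Polynomial.coeff_sub, Polynomial.coeff_C_mul, Polynomial.coeff_X_one, mul_one,
      Polynomial.coeff_C_of_ne_zero one_ne_zero, sub_zero] at this
  have hcop : IsCoprime x.num x.den := by
    rw [Int.isCoprime_iff_gcd_eq_one]
    exact x.reduced
  exact hcop.isUnit_of_dvd' h0 h1

/-- Gauss's lemma bounds the order of vanishing at a rational point. -/
lemma exists_taylor_coeff_ne_zero {W : Polynomial ℤ} (hW : W ≠ 0) (x : ℚ) :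
    ∃ l : ℕ, (Polynomial.taylor x (W.map (Int.castRingHom ℚ))).coeff l ≠ 0 ∧
      x.den ^ l ≤ W.leadingCoeff.natAbs := by
  have hW' : W.map (Int.castRingHom ℚ) ≠ 0 :=
    (Polynomial.map_ne_zero_iff (RingHom.injective_int _)).2 hW
  obtain ⟨Q, hQ, hdvd⟩ :=
    Polynomial.exists_eq_pow_rootMultiplicity_mul_and_not_dvd _ hW' x
  set l := Polynomial.rootMultiplicity x (W.map (Int.castRingHom ℚ)) with hl
  refine ⟨l, ?_, ?_⟩
  · rw [hQ, Polynomial.taylor_mul, Polynomial.taylor_pow, map_sub, Polynomial.taylor_X,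
      Polynomial.taylor_C, add_sub_cancel_right]
    have := Polynomial.coeff_X_pow_mul (Polynomial.taylor x Q) l 0
    rw [zero_add] at this
    rw [this, Polynomial.taylor_coeff_zero]
    rwa [Polynomial.dvd_iff_isRoot] at hdvd
  · set L := Polynomial.C (x.den : ℤ) * Polynomial.X - Polynomial.C x.num with hL
    have hprim : ∀ m : ℕ, (L ^ m).IsPrimitive := by
      intro m
      induction m with
      | zero => simp
      | succ m ih => rw [pow_succ]; exact ih.mul (isPrimitive_den_mul_X_sub_num x)
    have hden : (x.den : ℚ) ≠ 0 := by exact_mod_cast x.den_ne_zero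
    have hmapL : L.map (Int.castRingHom ℚ) =
        Polynomial.C (x.den : ℚ) * (Polynomial.X - Polynomial.C x) := by
      rw [hL, mul_sub, ← Polynomial.C_mul, Rat.den_mul_eq_num]
      simp
    have hdiv : L ^ l ∣ W := by
      refine (Polynomial.IsPrimitive.Int.dvd_iff_map_cast_dvd_map_cast _ _ (hprim l)).2 ?_
      rw [Polynomial.map_pow, hmapL, mul_pow, ← Polynomial.C_pow]
      refine (IsUnit.mul_left_dvd ?_).2 ⟨Q, hQ⟩
      exact Polynomial.isUnit_C.2 (pow_ne_zero _ hden).isUnit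
    obtain ⟨Q', hQ'⟩ := hdiv
    have hlcL : L.leadingCoeff = x.den := by
      rw [hL, sub_eq_add_neg, ← Polynomial.C_neg]
      exact Polynomial.leadingCoeff_linear (by exact_mod_cast x.den_ne_zero)
    have hQ0 : Q' ≠ 0 := by rintro rfl; exact hW (by simpa using hQ')
    rw [hQ', Polynomial.leadingCoeff_mul, Polynomial.leadingCoeff_pow, hlcL, Int.natAbs_mul,
      Int.natAbs_pow, Int.natAbs_natCast]
    exact Nat.le_mul_of_pos_right _ (Int.natAbs_pos.2 (Polynomial.leadingCoeff_ne_zero.2 hQ0))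

lemma le_sum_max_sub {k r : ℕ} {θ : ℝ} (h0 : 0 ≤ θ) (h1 : θ ≤ 1) (hk : k ≤ r + 1) (hr : 0 < r) :
    k * θ ^ 2 / 8 ≤ ∑ b ∈ Finset.range k, max 0 (θ - b / r) := by
  have hr' : (0 : ℝ) < r := by exact_mod_cast hr
  set m := min k (⌊θ * r / 2⌋₊ + 1) with hm
  have hmk : (k : ℝ) * θ / 4 ≤ m := by
    rw [hm, Nat.cast_min, le_min_iff]
    constructor
    · nlinarith [(Nat.cast_nonneg k : (0 : ℝ) ≤ k)]
    · have h2 := Nat.lt_floor_add_one (θ * r / 2)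
      have h3 : (k : ℝ) ≤ r + 1 := by exact_mod_cast hk
      have h4 : (1 : ℝ) ≤ r := by exact_mod_cast hr
      push_cast
      nlinarith
  have h2 : ∑ b ∈ Finset.range m, θ / 2 ≤ ∑ b ∈ Finset.range k, max 0 (θ - b / r) := by
    refine (Finset.sum_le_sum fun b hb => ?_).trans (Finset.sum_le_sum_of_subset_of_nonneg
      (Finset.range_mono (min_le_left _ _)) fun _ _ _ => le_max_left _ _)
    refine le_max_of_le_right ?_
    have hb' : b ≤ ⌊θ * r / 2⌋₊ :=
      Nat.le_of_lt_succ ((Finset.mem_range.1 hb).trans_le (min_le_right _ _))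
    have hb2 : (b : ℝ) ≤ θ * r / 2 := (Nat.le_floor_iff (by positivity)).1 hb'
    have : (b : ℝ) / r ≤ θ / 2 := by
      rw [div_le_iff₀ hr']
      linarith
    linarith
  rw [Finset.sum_const, Finset.card_range, nsmul_eq_mul] at h2
  nlinarith

lemma exists_hasse_det_eq_lift {n r : ℕ} {P : MvPolynomial (Fin (n + 1)) ℤ} (hP : P ≠ 0)
    (hr : ∀ e, coeff e P ≠ 0 → e 0 ≤ r) :
    ∃ (k : ℕ) (a : Fin k → Fin n →₀ ℕ) (b : Fin k → ℕ) (V : MvPolynomial (Fin n) ℚ)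
      (W : Polynomial ℚ), 0 < k ∧ k ≤ r + 1 ∧ (∀ i, ∑ h, a i h < k) ∧ Function.Injective b ∧
        (∀ i, b i < k) ∧ V ≠ 0 ∧ W ≠ 0 ∧
        map (Int.castRingHom ℚ) (Matrix.of fun i j => hasse ((a i).cons (b j)) P).det =
          liftTail V * liftHead n W := by
  obtain ⟨k, φ, ψ, hk, hφ, hψ, hdec⟩ := exists_decomposition (map (Int.castRingHom ℚ) P) r
    fun e he => hr e fun h => he (by rw [coeff_map, h, map_zero])
  obtain ⟨a, ha, hV⟩ := exists_hasse_det_ne_zero hφ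
  obtain ⟨b, hb, hbk, hW⟩ := exists_hasseDeriv_det_ne_zero hψ
  refine ⟨k, a, b, _, _, Nat.pos_of_ne_zero ?_, hk, ha, hb, hbk, hV, hW, ?_⟩
  · rintro rfl
    rw [Finset.univ_eq_empty, Finset.sum_empty] at hdec
    exact hP (map_injective _ (RingHom.injective_int _) (by rw [hdec, map_zero]))
  · rw [RingHom.map_det, RingHom.map_det, RingHom.map_det,
      ← Matrix.det_transpose ((liftHead n).mapMatrix _), ← Matrix.det_mul]
    congr 1
    ext1 i j
    simp only [RingHom.mapMatrix_apply, Matrix.map_apply, Matrix.of_apply, Matrix.mul_apply,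
      Matrix.transpose_apply]
    rw [map_hasse, hdec, hasse_sum]
    exact Finset.sum_congr rfl fun l _ => hasse_cons_lift _ _ _ _

lemma l1_coeff_finSuccEquiv_le {n : ℕ} (U : MvPolynomial (Fin (n + 1)) ℤ) (y : ℕ) :
    l1 ((finSuccEquiv ℤ n U).coeff y) ≤ l1 U := by
  classical
  have hinj : Function.Injective fun e : Fin n →₀ ℕ => e.cons y := Finsupp.cons_right_injective y
  simp only [l1, finSuccEquiv_coeff_coeff]
  rw [← Finset.sum_image (s := ((finSuccEquiv ℤ n U).coeff y).support)
    (g := fun e : Fin n →₀ ℕ => e.cons y) (f := fun e => ‖coeff e U‖) hinj.injOn]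
  refine Finset.sum_le_sum_of_subset_of_nonneg ?_ fun _ _ _ => norm_nonneg _
  intro e he
  obtain ⟨x, hx, rfl⟩ := Finset.mem_image.1 he
  rwa [mem_support_iff, finSuccEquiv_coeff_coeff, ← mem_support_iff] at hx

variable {n : ℕ}

lemma exists_coeff_taylor_lift {U : MvPolynomial (Fin (n + 1)) ℤ} {V : MvPolynomial (Fin n) ℚ}
    {W : Polynomial ℚ} (hW : W ≠ 0)
    (hU : map (Int.castRingHom ℚ) U = liftTail V * liftHead n W) (x : Fin (n + 1) → ℚ)
    (hV : V ≠ 0) :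
    ∃ (V' : MvPolynomial (Fin n) ℤ) (l : ℕ), V' ≠ 0 ∧ l1 V' ≤ l1 U ∧
      (∀ e, coeff e V' ≠ 0 → ∃ y, coeff (e.cons y) U ≠ 0) ∧ ((x 0).den : ℝ) ^ l ≤ l1 U ∧
      ∀ i, coeff i (taylor (Fin.tail x) (map (Int.castRingHom ℚ) V')) ≠ 0 →
        coeff (i.cons l) (taylor x (map (Int.castRingHom ℚ) U)) ≠ 0 := by
  have hcoeff (y : ℕ) (e : Fin n →₀ ℕ) : ((coeff (e.cons y) U : ℤ) : ℚ) = coeff e V * W.coeff y := by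
    rw [← coeff_cons_lift, ← hU, coeff_map]; rfl
  obtain ⟨y₀, hy₀⟩ : ∃ y, W.coeff y ≠ 0 := by
    by_contra! h
    exact hW (Polynomial.ext h)
  obtain ⟨i₀, hi₀⟩ : ∃ i, coeff i V ≠ 0 := by
    by_contra! h
    exact hV (MvPolynomial.ext _ _ h)
  set V' := (finSuccEquiv ℤ n U).coeff y₀ with hV'
  have hmapV : map (Int.castRingHom ℚ) V' = C (W.coeff y₀) * V := by
    ext e
    rw [coeff_map, coeff_C_mul, hV', finSuccEquiv_coeff_coeff, mul_comm, ← hcoeff]; rfl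
  let W' : Polynomial ℤ := ∑ y ∈ Finset.range (W.natDegree + 1),
    Polynomial.monomial y (coeff (i₀.cons y) U)
  have hW'c (y : ℕ) : W'.coeff y = coeff (i₀.cons y) U := by
    simp only [W', Polynomial.finsetSum_coeff, Polynomial.coeff_monomial]
    rw [Finset.sum_ite_eq' (Finset.range (W.natDegree + 1))]
    split_ifs with hy
    · rfl
    · have : W.coeff y = 0 := Polynomial.coeff_eq_zero_of_natDegree_lt (by simpa using hy)
      have h := hcoeff y i₀
      rw [this, mul_zero] at h
      exact_mod_cast h.symm
  have hmapW : W'.map (Int.castRingHom ℚ) = Polynomial.C (coeff i₀ V) * W := by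
    ext y
    rw [Polynomial.coeff_map, hW'c, Polynomial.coeff_C_mul, ← hcoeff]; rfl
  have hW'0 : W' ≠ 0 := by
    intro h
    have := hW'c y₀
    rw [h, Polynomial.coeff_zero] at this
    have h2 := hcoeff y₀ i₀
    rw [← this] at h2
    exact mul_ne_zero hi₀ hy₀ (by exact_mod_cast h2.symm)
  obtain ⟨l, hl, hle⟩ := exists_taylor_coeff_ne_zero hW'0 (x 0)
  refine ⟨V', l, ?_, l1_coeff_finSuccEquiv_le _ _, ?_, ?_, ?_⟩
  · intro h
    have : coeff i₀ (map (Int.castRingHom ℚ) V') = 0 := by rw [h]; simp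
    rw [hmapV, coeff_C_mul] at this
    exact mul_ne_zero hy₀ hi₀ this
  · intro e he
    exact ⟨y₀, by rwa [hV', finSuccEquiv_coeff_coeff] at he⟩
  · have h1 : ((x 0).den : ℝ) ^ l ≤ W'.leadingCoeff.natAbs := by exact_mod_cast hle
    refine h1.trans ?_
    rw [Polynomial.leadingCoeff, hW'c, Nat.cast_natAbs, Int.cast_abs, ← Int.norm_eq_abs]
    exact norm_coeff_le_l1 _ _
  · intro i hi
    rw [hmapV, map_mul, ← algebraMap_eq, AlgHom.commutes, algebraMap_eq, coeff_C_mul] at hi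
    rw [hmapW, Polynomial.taylor_mul, Polynomial.taylor_C, Polynomial.coeff_C_mul] at hl
    rw [hU, map_mul, taylor_liftTail, taylor_liftHead, coeff_cons_lift]
    exact mul_ne_zero (right_ne_zero_of_mul hi) (right_ne_zero_of_mul hl)

/-- Roth's lemma: a polynomial with small coefficients has small index at a rational point whose
coordinates have large denominators. -/
theorem exists_coeff_taylor_ne_zero_of_l1_le (n : ℕ) : ∀ ε : ℝ, 0 < ε → ∃ ω : ℝ, 0 < ω ∧
    ∀ (r : Fin n → ℕ) (x : Fin n → ℚ) (T : ℝ) (P : MvPolynomial (Fin n) ℤ), (∀ h, 0 < r h) →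
      (∀ i j, i < j → (r i : ℝ) ≤ ω * r j) → (∀ h, T ≤ r h * Real.log (x h).den) →
      ∑ h, (r h : ℝ) ≤ ω * T → P ≠ 0 → (∀ e, coeff e P ≠ 0 → ∀ h, e h ≤ r h) →
      l1 P ≤ Real.exp (ω * T) →
      ∃ i, coeff i (taylor x (map (Int.castRingHom ℚ) P)) ≠ 0 ∧ wt r i ≤ ε := by
  induction n with
  | zero =>
    intro ε hε
    refine ⟨1, one_pos, fun r x T P _ _ _ _ hP _ _ => ?_⟩
    have h0 : taylor x (map (Int.castRingHom ℚ) P) ≠ 0 := by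
      rw [Ne, map_eq_zero_iff _ (taylor_injective x),
        map_eq_zero_iff _ (map_injective _ (RingHom.injective_int _))]
      exact hP
    obtain ⟨i, hi⟩ : ∃ i, coeff i (taylor x (map (Int.castRingHom ℚ) P)) ≠ 0 := by
      by_contra! h
      exact h0 (MvPolynomial.ext _ _ h)
    exact ⟨i, hi, by simpa [wt_apply] using hε.le⟩
  | succ n ih =>
    intro ε₁ hε₁
    set ε := min ε₁ 1 with hε
    have hε0 : 0 < ε := lt_min hε₁ one_pos
    have hε1 : ε ≤ 1 := min_le_right _ _
    obtain ⟨ω', hω', IH⟩ := ih (ε ^ 2 / 128) (by positivity)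
    set ω := min (ω' / 4) (ε ^ 2 / 512) with hω
    have hω0 : 0 < ω := lt_min (by positivity) (by positivity)
    have hω1 : 4 * ω ≤ ω' := by have := min_le_left (ω' / 4) (ε ^ 2 / 512); linarith
    have hω2 : ω ≤ ε ^ 2 / 512 := min_le_right _ _
    refine ⟨ω, hω0, fun r x T P hr hord hT hsum hP hdeg hl1 => ?_⟩
    by_contra! hcon
    have hidx : SuppGE (wt r) ε (taylor x (map (Int.castRingHom ℚ) P)) :=
      fun i hi => (min_le_left _ _).trans (hcon i hi).le
    obtain ⟨k, a, b, V, W, hk, hkr, ha, hb, hbk, hV, hW, hU⟩ :=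
      exists_hasse_det_eq_lift hP (r := r 0) fun e he => hdeg e he 0
    have hk' : (0 : ℝ) < k := by exact_mod_cast hk
    have hr0 : (1 : ℝ) ≤ r 0 := by exact_mod_cast hr 0
    have hr0s : (r 0 : ℝ) ≤ ∑ h, (r h : ℝ) :=
      Finset.single_le_sum (f := fun h => (r h : ℝ)) (fun _ _ => Nat.cast_nonneg _)
        (Finset.mem_univ 0)
    have hωT : 0 < ω * T := by linarith
    have hT0 : 0 < T := pos_of_mul_pos_right hωT hω0.le
    set M : Matrix (Fin k) (Fin k) (MvPolynomial (Fin (n + 1)) ℤ) :=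
      Matrix.of fun i j => hasse ((a i).cons (b j)) P with hM
    -- the size of the determinant
    have hUl1 : l1 M.det ≤ Real.exp (3 * ω * (k * T)) := by
      have h1 : ∀ i j, l1 (M i j) ≤ Real.exp (2 * (ω * T)) := by
        intro i j
        have hD (e) (he : coeff e P ≠ 0) : ∑ h, e h ≤ ∑ h, r h :=
          Finset.sum_le_sum fun h _ => hdeg e he h
        refine (l1_hasse_le hD _).trans ?_
        rw [two_mul, Real.exp_add]
        refine mul_le_mul ?_ hl1 (l1_nonneg _) (Real.exp_pos _).le
        calc (2 : ℝ) ^ (∑ h, r h) ≤ Real.exp 1 ^ (∑ h, r h) :=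
              pow_le_pow_left₀ zero_le_two (by linarith [Real.add_one_le_exp (1 : ℝ)]) _
          _ = Real.exp (∑ h, (r h : ℝ)) := by rw [← Real.exp_nat_mul]; simp
          _ ≤ _ := Real.exp_le_exp.2 hsum
      refine (l1_det_le h1).trans ?_
      have h2 : (k : ℝ) ≤ Real.exp (ω * T) := by
        have : (k : ℝ) ≤ r 0 + 1 := by exact_mod_cast hkr
        exact this.trans ((Real.add_one_le_exp _).trans (Real.exp_le_exp.2 (hr0s.trans hsum)))
      have h3 : (k.factorial : ℝ) ≤ (k : ℝ) ^ k := by exact_mod_cast Nat.factorial_le_pow k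
      calc (k.factorial : ℝ) * Real.exp (2 * (ω * T)) ^ k
          ≤ Real.exp (ω * T) ^ k * Real.exp (2 * (ω * T)) ^ k := by
            gcongr
            exact h3.trans (pow_le_pow_left₀ hk'.le h2 k)
        _ = _ := by
            rw [← Real.exp_nat_mul, ← Real.exp_nat_mul, ← Real.exp_add]
            ring_nf
    -- the degrees of the determinant
    have hUdeg : ∀ e, coeff e M.det ≠ 0 → ∀ h, e h ≤ k * r h := by
      intro e he h
      have h1 : SuppGE (negDeg h) (-(r h : ℝ)) P := by
        intro e he
        rw [negDeg_apply, neg_le_neg_iff]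
        exact_mod_cast hdeg e he h
      have h2 : SuppGE (negDeg h) (∑ _ : Fin k, -(r h : ℝ)) M.det := by
        refine SuppGE.det fun i j => (h1.hasse _).mono ?_
        rw [negDeg_apply]
        linarith [Nat.cast_nonneg (α := ℝ) ((Finsupp.cons (b j) (a i)) h)]
      have h3 := h2 e he
      rw [negDeg_apply, Finset.sum_const, Finset.card_univ, Fintype.card_fin, nsmul_eq_mul] at h3
      have : (e h : ℝ) ≤ k * r h := by linarith
      exact_mod_cast this
    -- the index of the determinant
    have hUidx : SuppGE (wt r) (∑ j, max 0 (ε - ω - b j / r 0))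
        (taylor x (map (Int.castRingHom ℚ) M.det)) := by
      rw [RingHom.map_det, AlgHom.map_det]
      refine SuppGE.det fun i j => ?_
      simp only [RingHom.mapMatrix_apply, AlgHom.mapMatrix_apply, Matrix.map_apply, hM,
        Matrix.of_apply]
      rw [map_hasse, ← hasse_taylor]
      rcases max_cases 0 (ε - ω - b j / r 0) with ⟨h, -⟩ | ⟨h, -⟩
      · rw [h]
        exact fun e _ => wt_nonneg r e
      · rw [h]
        refine (hidx.hasse _).mono ?_
        have h1 : wt r ((a i).cons (b j)) ≤ b j / r 0 + ω := by
          rw [wt_apply, Fin.sum_univ_succ]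
          simp only [Finsupp.cons_zero, Finsupp.cons_succ]
          gcongr
          calc ∑ h, (a i h : ℝ) / r (Fin.succ h) ≤ ∑ h, (a i h : ℝ) * (ω / r 0) := by
                refine Finset.sum_le_sum fun h _ => ?_
                rw [div_eq_mul_inv]
                gcongr
                have h2 := hord 0 h.succ (Fin.succ_pos h)
                have h3 : (0 : ℝ) < r h.succ := by exact_mod_cast hr _
                rw [inv_eq_one_div, div_le_div_iff₀ h3 (by linarith)]
                linarith
            _ = (∑ h, a i h : ℕ) * (ω / r 0) := by rw [← Finset.sum_mul]; push_cast; rfl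
            _ ≤ r 0 * (ω / r 0) := by
                gcongr
                have := ha i
                omega
            _ = ω := by field_simp
        linarith
    have hθ : k * (ε - ω) ^ 2 / 8 ≤ ∑ j, max 0 (ε - ω - b j / r 0) := by
      refine (le_sum_max_sub (by nlinarith) (by linarith) hkr (hr 0)).trans_eq ?_
      have : Finset.range k = Finset.univ.image b := by
        symm
        refine Finset.eq_of_subset_of_card_le ?_ ?_
        · intro y hy
          obtain ⟨j, -, rfl⟩ := Finset.mem_image.1 hy
          exact Finset.mem_range.2 (hbk j)
        · rw [Finset.card_image_of_injective _ hb]; simp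
      rw [this, Finset.sum_image hb.injOn]
    obtain ⟨V', l, hV'0, hV'l1, hV'deg, hl, hV'⟩ := exists_coeff_taylor_lift hW hU x hV
    obtain ⟨i, hi, hwi⟩ := IH (fun h => k * r h.succ) (Fin.tail x) (k * T) V'
      (fun h => Nat.mul_pos hk (hr _))
      (fun i j hij => by
        have h1 := hord i.succ j.succ (Fin.succ_lt_succ_iff.2 hij)
        have h2 : ω * r j.succ ≤ ω' * r j.succ := by
          gcongr
          linarith
        push_cast
        calc (k : ℝ) * r i.succ ≤ k * (ω' * r j.succ) := by gcongr; linarith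
          _ = _ := by ring)
      (fun h => by
        have := hT h.succ
        push_cast
        rw [mul_assoc]
        exact mul_le_mul_of_nonneg_left this hk'.le)
      (by
        push_cast
        rw [← Finset.mul_sum]
        rw [Fin.sum_univ_succ] at hsum
        calc (k : ℝ) * ∑ h : Fin n, (r h.succ : ℝ) ≤ k * (ω' * T) := by
              gcongr
              nlinarith
          _ = _ := by ring)
      hV'0
      (fun e he h => by
        obtain ⟨y, hy⟩ := hV'deg e he
        simpa using hUdeg _ hy h.succ)
      (hV'l1.trans (hUl1.trans (Real.exp_le_exp.2 (by gcongr; linarith))))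
    have hfin := hUidx _ (hV' i hi)
    have hl2 : (l : ℝ) / r 0 ≤ 3 * ω * k := by
      have hlog : 0 < Real.log (x 0).den := pos_of_mul_pos_right (hT0.trans_le (hT 0)) (by linarith)
      have h1 : (l : ℝ) * Real.log (x 0).den ≤ 3 * ω * (k * T) := by
        rw [← Real.log_pow, Real.log_le_iff_le_exp (by have := (x 0).den_pos; positivity)]
        exact hl.trans hUl1
      rw [div_le_iff₀ (by linarith)]
      refine le_of_mul_le_mul_right ?_ hlog
      calc _ ≤ 3 * ω * (k * T) := h1
        _ ≤ 3 * ω * (k * (r 0 * Real.log (x 0).den)) := by gcongr; exact hT 0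
        _ = _ := by ring
    have hw : wt r (i.cons l) ≤ 3 * ω * k + k * (ε ^ 2 / 128) := by
      rw [wt_apply, Fin.sum_univ_succ]
      simp only [Finsupp.cons_zero, Finsupp.cons_succ]
      refine add_le_add hl2 ?_
      rw [wt_apply] at hwi
      calc ∑ h, (i h : ℝ) / r (Fin.succ h) = k * ∑ h, (i h : ℝ) / ((k * r (Fin.succ h) : ℕ) : ℝ) := by
            rw [Finset.mul_sum]
            refine Finset.sum_congr rfl fun h _ => ?_
            push_cast
            have : (0 : ℝ) < r h.succ := by exact_mod_cast hr _
            field_simp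
        _ ≤ _ := by gcongr
    have h4 : (ε - ω) ^ 2 / 8 ≤ 3 * ω + ε ^ 2 / 128 := by
      refine le_of_mul_le_mul_left ?_ hk'
      linarith
    have h5 : ω ≤ ε / 4 := by nlinarith
    nlinarith [mul_self_le_mul_self (by positivity : 0 ≤ 3 * ε / 4) (by linarith : 3 * ε / 4 ≤ ε - ω)]

end RothLemma

section AuxiliaryPolynomial

lemma exists_pow_eq_sum {β : ℝ} (hβ : IsIntegral ℤ β) :
    ∃ (d B : ℕ) (A : ℕ → Fin d → ℤ), 0 < d ∧ 1 ≤ B ∧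
      ∀ l, β ^ l = ∑ j, A l j * β ^ (j : ℕ) ∧ ∀ j, |(A l j : ℝ)| ≤ B ^ l := by
  obtain ⟨p, hp, hpβ⟩ := hβ
  obtain ⟨d, hd⟩ : ∃ d, p.natDegree = d + 1 := by
    refine Nat.exists_eq_succ_of_ne_zero fun h => ?_
    rw [hp.natDegree_eq_zero.1 h] at hpβ
    simp at hpβ
  have hroot : β ^ (d + 1) = -∑ j : Fin (d + 1), (p.coeff j : ℝ) * β ^ (j : ℕ) := by
    rw [Polynomial.eval₂_eq_sum_range, hd, Finset.sum_range_succ, ← hd,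
      Polynomial.coeff_natDegree, hp.leadingCoeff, hd, Finset.sum_range] at hpβ
    simp at hpβ
    linarith
  set H : ℕ := ∑ j : Fin (d + 1), (p.coeff j).natAbs with hH
  have key (l : ℕ) : ∃ A : Fin (d + 1) → ℤ, β ^ l = ∑ j, A j * β ^ (j : ℕ) ∧
      ∀ j, |(A j : ℝ)| ≤ ((1 + H : ℕ) : ℝ) ^ l := by
    induction l with
    | zero =>
      refine ⟨fun j => if j = 0 then 1 else 0, by simp, fun j => ?_⟩
      by_cases h : j = 0 <;> simp [h]
    | succ l ih =>
      obtain ⟨A, hA, hAb⟩ := ih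
      refine ⟨fun j => Fin.cases 0 (fun j => A j.castSucc) j - A (Fin.last d) * p.coeff j, ?_,
        fun j => ?_⟩
      · push_cast
        simp_rw [sub_mul]
        rw [Finset.sum_sub_distrib, pow_succ', hA, Fin.sum_univ_castSucc, Fin.sum_univ_succ,
          mul_add, Finset.mul_sum]
        simp only [mul_assoc, ← Finset.mul_sum, Fin.cases_zero, Fin.cases_succ, Fin.val_castSucc,
          Fin.val_last, Fin.val_succ, Int.cast_zero, zero_mul, zero_add]
        rw [mul_left_comm β _ (β ^ d), ← pow_succ', hroot]
        simp only [pow_succ]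
        rw [mul_neg, ← sub_eq_add_neg]
        congr 1
        rw [Finset.mul_sum]
        exact Finset.sum_congr rfl fun j _ => by ring
      · have h1 : |((Fin.cases 0 (fun j => A j.castSucc) j : ℤ) : ℝ)| ≤ ((1 + H : ℕ) : ℝ) ^ l := by
          refine Fin.cases ?_ (fun j => ?_) j
          · simp only [Fin.cases_zero, Int.cast_zero, abs_zero]
            positivity
          · exact hAb _
        have h2 : |(p.coeff j : ℝ)| ≤ H := by
          have := Finset.single_le_sum (f := fun j : Fin (d + 1) => (p.coeff j).natAbs)
            (fun _ _ => Nat.zero_le _) (Finset.mem_univ j)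
          rw [← Int.cast_abs, Int.abs_eq_natAbs]
          exact_mod_cast this
        push_cast at h1 ⊢
        refine (abs_sub _ _).trans ?_
        rw [abs_mul, pow_succ, mul_add, mul_one]
        have h3 := hAb (Fin.last d)
        push_cast at h3
        gcongr
  choose A hA using key
  exact ⟨d + 1, 1 + H, A, d.succ_pos, by omega, hA⟩

lemma sum_exp_le {r : ℕ} (hr : 0 < r) {ε : ℝ} (h0 : 0 ≤ ε) (h1 : ε ≤ 1 / 2) :
    ∑ i : Fin (r + 1), Real.exp (2 * ε * (1 / 2 - (i : ℕ) / r)) ≤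
      (r + 1 : ℕ) * Real.exp (ε ^ 2) := by
  have hr' : (0 : ℝ) < r := by exact_mod_cast hr
  have hsum : ∑ i : Fin (r + 1), (1 / 2 - ((i : ℕ) : ℝ) / r) = 0 := by
    rw [Finset.sum_sub_distrib, ← Finset.sum_div _ (fun i : Fin (r + 1) => ((i : ℕ) : ℝ)),
      Fin.sum_univ_eq_sum_range (fun i => (i : ℝ))]
    have h2 : (∑ i ∈ Finset.range (r + 1), (i : ℝ)) * 2 = (r + 1) * r := by
      have := congr_arg (Nat.cast (R := ℝ)) (Finset.sum_range_id_mul_two (r + 1))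
      rw [Nat.add_sub_cancel] at this
      push_cast at this
      exact this
    have h3 : ∑ i ∈ Finset.range (r + 1), (i : ℝ) = (r + 1) * r / 2 := by linarith
    rw [h3]
    simp
    field_simp
    ring
  calc ∑ i : Fin (r + 1), Real.exp (2 * ε * (1 / 2 - (i : ℕ) / r))
      ≤ ∑ i : Fin (r + 1), (1 + ε ^ 2 + 2 * ε * (1 / 2 - (i : ℕ) / r)) := by
        refine Finset.sum_le_sum fun i _ => ?_
        have h2 : ((i : ℕ) : ℝ) / r ≤ 1 := by
          rw [div_le_one hr']
          exact_mod_cast Nat.le_of_lt_succ i.2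
        have h3 : (0 : ℝ) ≤ ((i : ℕ) : ℝ) / r := by positivity
        set y := ((i : ℕ) : ℝ) / r
        have h4 : |2 * ε * (1 / 2 - y)| ≤ ε := by
          rw [abs_le]
          constructor <;> nlinarith
        have h5 := (abs_le.1 (Real.abs_exp_sub_one_sub_id_le (h4.trans (by linarith)))).2
        have h6 : (2 * ε * (1 / 2 - y)) ^ 2 ≤ ε ^ 2 := sq_le_sq' (by linarith [(abs_le.1 h4).1])
          (abs_le.1 h4).2
        linarith
    _ = (r + 1 : ℕ) * (1 + ε ^ 2) := by
        rw [Finset.sum_add_distrib, ← Finset.mul_sum, hsum]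
        simp
        ring
    _ ≤ _ := by
        gcongr
        linarith [Real.add_one_le_exp (ε ^ 2)]

lemma card_filter_lt_le {m : ℕ} {r : Fin m → ℕ} (hr : ∀ h, 0 < r h) {ε : ℝ} (h0 : 0 ≤ ε)
    (h1 : ε ≤ 1 / 2) :
    ((Finset.univ.filter fun i : ∀ h, Fin (r h + 1) =>
      ∑ h, ((i h : ℕ) : ℝ) / r h < m * (1 / 2 - ε)).card : ℝ) ≤
      Real.exp (-(m * ε ^ 2)) * ∏ h, ((r h + 1 : ℕ) : ℝ) := by
  have hpt (i : ∀ h, Fin (r h + 1)) : ∏ h, Real.exp (2 * ε * (1 / 2 - (i h : ℕ) / r h)) =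
      Real.exp (2 * ε * (m * (1 / 2) - ∑ h, ((i h : ℕ) : ℝ) / r h)) := by
    rw [← Real.exp_sum, ← Finset.mul_sum, Finset.sum_sub_distrib]
    simp
  calc _ = ∑ i ∈ Finset.univ.filter fun i : ∀ h, Fin (r h + 1) =>
        ∑ h, ((i h : ℕ) : ℝ) / r h < m * (1 / 2 - ε), (1 : ℝ) := by simp
    _ ≤ ∑ i ∈ Finset.univ.filter fun i : ∀ h, Fin (r h + 1) =>
          ∑ h, ((i h : ℕ) : ℝ) / r h < m * (1 / 2 - ε),
          Real.exp (-(2 * (m * ε ^ 2))) * ∏ h, Real.exp (2 * ε * (1 / 2 - (i h : ℕ) / r h)) := by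
        refine Finset.sum_le_sum fun i hi => ?_
        rw [hpt, ← Real.exp_add]
        refine Real.one_le_exp ?_
        have := (Finset.mem_filter.1 hi).2
        nlinarith
    _ ≤ ∑ i : ∀ h, Fin (r h + 1),
          Real.exp (-(2 * (m * ε ^ 2))) * ∏ h, Real.exp (2 * ε * (1 / 2 - (i h : ℕ) / r h)) :=
        Finset.sum_le_sum_of_subset_of_nonneg (Finset.filter_subset _ _)
          fun _ _ _ => mul_nonneg (Real.exp_pos _).le
            (Finset.prod_nonneg fun _ _ => (Real.exp_pos _).le)
    _ = Real.exp (-(2 * (m * ε ^ 2))) *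
          ∏ h, ∑ i : Fin (r h + 1), Real.exp (2 * ε * (1 / 2 - (i : ℕ) / r h)) := by
        rw [← Finset.mul_sum, Finset.prod_univ_sum, Fintype.piFinset_univ]
    _ ≤ Real.exp (-(2 * (m * ε ^ 2))) * ∏ h, (((r h + 1 : ℕ) : ℝ) * Real.exp (ε ^ 2)) := by
        gcongr with h _
        exact sum_exp_le (hr h) h0 h1
    _ = _ := by
        rw [Finset.prod_mul_distrib, Finset.prod_const, Finset.card_univ, Fintype.card_fin,
          ← Real.exp_nat_mul, mul_left_comm, ← Real.exp_add, mul_comm]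
        congr 2
        ring

section Siegel

attribute [local instance] Matrix.seminormedAddCommGroup

/-- Siegel's lemma for at least twice as many unknowns as equations. -/
lemma exists_int_vec_abs_le {ι κ : Type*} [Fintype ι] [Fintype κ] (A : Matrix ι κ ℤ) {B : ℝ}
    (hB : 1 ≤ B) (hA : ∀ i j, |(A i j : ℝ)| ≤ B) (hι : 0 < Fintype.card ι)
    (hcard : 2 * Fintype.card ι ≤ Fintype.card κ) :
    ∃ t : κ → ℤ, t ≠ 0 ∧ (∀ i, ∑ j, A i j * t j = 0) ∧
      ∀ j, |(t j : ℝ)| ≤ Fintype.card κ * B := by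
  obtain ⟨t, ht, hAt, hle⟩ := Int.Matrix.exists_ne_zero_int_vec_norm_le A (by omega) hι
  refine ⟨t, ht, fun i => congr_fun hAt i, fun j => ?_⟩
  have hn : (1 : ℝ) ≤ Fintype.card κ := by
    have : 1 ≤ Fintype.card κ := by omega
    exact_mod_cast this
  have hAB : ‖A‖ ≤ B := (Matrix.norm_le_iff (by linarith)).2 fun i j => by
    rw [Int.norm_eq_abs]
    exact hA i j
  have hcard' : 2 * (Fintype.card ι : ℝ) ≤ Fintype.card κ := by exact_mod_cast hcard
  have hι' : (0 : ℝ) < Fintype.card ι := by exact_mod_cast hι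
  calc |(t j : ℝ)| = ‖t j‖ := (Int.norm_eq_abs _).symm
    _ ≤ ‖t‖ := norm_le_pi_norm t j
    _ ≤ _ := hle
    _ ≤ ((Fintype.card κ : ℝ) * max 1 ‖A‖) ^ (1 : ℝ) := by
        refine Real.rpow_le_rpow_of_exponent_le ?_ ?_
        · nlinarith [le_max_left 1 ‖A‖]
        · rw [div_le_one (by linarith)]
          linarith
    _ = (Fintype.card κ : ℝ) * max 1 ‖A‖ := Real.rpow_one _
    _ ≤ _ := by
        gcongr
        exact max_le hB hAB

end Siegel

/-- A nonzero integer polynomial of multidegree at most `r` with small coefficients and large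
index at the diagonal point `(β, …, β)`. -/
theorem exists_auxiliary_polynomial {β : ℝ} (hβ : IsIntegral ℤ β) :
    ∃ c : ℝ, 1 ≤ c ∧ ∀ ε : ℝ, 0 < ε → ε < 1 / 2 → ∃ m : ℕ, 0 < m ∧
      ∀ r : Fin m → ℕ, (∀ h, 0 < r h) → ∃ P : MvPolynomial (Fin m) ℤ, P ≠ 0 ∧
        (∀ e, coeff e P ≠ 0 → ∀ h, e h ≤ r h) ∧ l1 P ≤ c ^ ∑ h, r h ∧
        SuppGE (wt r) (m * (1 / 2 - ε))
          (taylor (fun _ => β) (map (Int.castRingHom ℝ) P)) := by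
  classical
  obtain ⟨d, B, A, hd, hB, hA⟩ := exists_pow_eq_sum hβ
  have hB' : (1 : ℝ) ≤ B := by exact_mod_cast hB
  have hd' : (0 : ℝ) < d := by exact_mod_cast hd
  refine ⟨8 * B, by linarith, fun ε hε0 hε1 => ?_⟩
  obtain ⟨m, hm⟩ := exists_nat_gt (2 * d / ε ^ 2)
  rw [div_lt_iff₀ (by positivity)] at hm
  have hm0 : 0 < m := by
    rw [Nat.pos_iff_ne_zero]
    rintro rfl
    rw [Nat.cast_zero, zero_mul] at hm
    linarith
  refine ⟨m, hm0, fun r hr => ?_⟩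
  let κ := ∀ h, Fin (r h + 1)
  let toF : κ → Fin m →₀ ℕ := fun i => Finsupp.equivFunOnFinite.symm fun h => (i h : ℕ)
  have htoF (i : κ) (h : Fin m) : toF i h = i h := rfl
  have htoF_inj : Function.Injective toF := fun i j hij => by
    funext h
    exact Fin.ext (DFunLike.congr_fun hij h)
  set D := ∑ h, r h with hD
  set S := Finset.univ.filter fun i : κ => ∑ h, ((i h : ℕ) : ℝ) / r h < m * (1 / 2 - ε) with hS
  have hκ : (Fintype.card κ : ℝ) = ∏ h, ((r h + 1 : ℕ) : ℝ) := by
    rw [Fintype.card_pi]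
    simp
  have hκ2 : (Fintype.card κ : ℝ) ≤ 2 ^ D := by
    rw [hκ, hD, ← Finset.prod_pow_eq_pow_sum]
    refine Finset.prod_le_prod (fun _ _ => Nat.cast_nonneg _) fun h _ => ?_
    exact_mod_cast Nat.lt_two_pow_self
  have hScard : 2 * (S.card * d) ≤ Fintype.card κ := by
    have h1 := card_filter_lt_le hr hε0.le hε1.le
    rw [← hκ, Real.exp_neg, ← div_eq_inv_mul, le_div_iff₀ (Real.exp_pos _)] at h1
    have h2 : (S.card : ℝ) * (2 * d) ≤ Fintype.card κ := by
      refine le_trans ?_ h1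
      gcongr
      linarith [Real.add_one_le_exp (m * ε ^ 2)]
    have h3 : 2 * ((S.card : ℝ) * d) ≤ Fintype.card κ := by linarith
    exact_mod_cast h3
  have hSpos : 0 < S.card := by
    refine Finset.card_pos.2 ⟨fun _ => 0, ?_⟩
    simp only [hS, Finset.mem_filter, Finset.mem_univ, true_and, Fin.val_zero, Nat.cast_zero,
      zero_div, Finset.sum_const_zero]
    have : (0 : ℝ) < m := by exact_mod_cast hm0
    nlinarith
  have hchoose (i e : κ) : (mchoose (toF e) (toF i) : ℝ) ≤ 2 ^ D := by
    have h1 := mchoose_le (toF e) (toF i)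
    have h2 : ∑ h, toF e h ≤ D := Finset.sum_le_sum fun h _ => Nat.le_of_lt_succ (e h).2
    have h3 := h1.trans (Nat.pow_le_pow_right two_pos h2)
    exact_mod_cast h3
  obtain ⟨t, ht, hMt, hle⟩ := exists_int_vec_abs_le (ι := S × Fin d) (κ := κ)
    (Matrix.of fun (i : S × Fin d) (e : κ) =>
      (mchoose (toF e) (toF i.1) : ℤ) * A (∑ h, (toF e h - toF i.1 h)) i.2)
    (B := (2 * B) ^ D) (one_le_pow₀ (by linarith))
    (by
      rintro ⟨i, j⟩ e
      simp only [Matrix.of_apply]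
      push_cast
      rw [abs_mul, mul_pow, Nat.abs_cast]
      have h1 : ∑ h, (toF e h - toF i h) ≤ D :=
        Finset.sum_le_sum fun h _ => (Nat.sub_le _ _).trans (Nat.le_of_lt_succ (e h).2)
      have h2 := ((hA (∑ h, (toF e h - toF i h))).2 j).trans (pow_le_pow_right₀ hB' h1)
      have h3 := hchoose i e
      gcongr)
    (by simpa using ⟨Finset.card_pos.1 hSpos, hd⟩) (by simpa using hScard)
  refine ⟨∑ e : κ, monomial (toF e) (t e), ?_, ?_, ?_, ?_⟩
  · intro h
    refine ht (funext fun e => ?_)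
    have := congr_arg (coeff (toF e)) h
    rw [coeff_sum, coeff_zero] at this
    simp_rw [coeff_monomial, htoF_inj.eq_iff] at this
    rwa [Finset.sum_ite_eq' Finset.univ e, if_pos (Finset.mem_univ e)] at this
  · intro e he h
    rw [coeff_sum] at he
    obtain ⟨i, -, hi⟩ := Finset.exists_ne_zero_of_sum_ne_zero he
    rw [coeff_monomial] at hi
    have : toF i = e := by
      by_contra h
      exact hi (if_neg h)
    rw [← this, htoF]
    exact Nat.le_of_lt_succ (i h).2
  · refine (l1_sum_le _ _).trans ?_
    calc ∑ e : κ, l1 (monomial (toF e) (t e)) ≤ ∑ e : κ, (Fintype.card κ : ℝ) * (2 * B) ^ D := by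
          refine Finset.sum_le_sum fun e _ => ?_
          rw [l1_monomial, Int.norm_eq_abs]
          exact hle e
      _ = (Fintype.card κ : ℝ) * (Fintype.card κ * (2 * B) ^ D) := by
          rw [Finset.sum_const, nsmul_eq_mul, Finset.card_univ]
      _ ≤ 2 ^ D * (2 ^ D * (2 * B) ^ D) := by gcongr
      _ = _ := by
          rw [← mul_pow, ← mul_pow]
          ring_nf
  · intro i hi
    by_contra! hlt
    refine hi ?_
    rw [map_sum, map_sum, coeff_sum]
    simp_rw [map_monomial, coeff_taylor_monomial, Finset.prod_pow_eq_pow_sum]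
    by_cases hir : ∀ h, i h ≤ r h
    · let i' : κ := fun h => ⟨i h, Nat.lt_succ_of_le (hir h)⟩
      have hi' : toF i' = i := by ext h; rfl
      have hiS : i' ∈ S := by
        rw [hS, Finset.mem_filter]
        exact ⟨Finset.mem_univ _, hlt⟩
      rw [← hi']
      simp_rw [fun e : κ => (hA (∑ h, (toF e h - toF i' h))).1, Finset.mul_sum]
      rw [Finset.sum_comm]
      refine Finset.sum_eq_zero fun j _ => ?_
      have h1 := congr_arg (Int.cast (R := ℝ)) (hMt (⟨i', hiS⟩, j))
      simp only [Matrix.of_apply] at h1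
      push_cast at h1
      rw [← zero_mul (β ^ (j : ℕ)), ← h1, Finset.sum_mul]
      refine Finset.sum_congr rfl fun e _ => ?_
      simp only [eq_intCast]
      ring
    · refine Finset.sum_eq_zero fun e _ => ?_
      rw [mchoose_eq_zero]
      · simp
      · intro h
        exact hir fun k => (h k).trans (Nat.le_of_lt_succ (e k).2)

end AuxiliaryPolynomial

section Contradiction

lemma l1_taylor_le {σ : Type*} [Fintype σ] {b : ℝ} (a : σ → ℝ) (ha : ∀ h, |a h| ≤ b)
    {P : MvPolynomial σ ℝ} {D : ℕ} (hb : 0 ≤ b) (hD : ∀ e, coeff e P ≠ 0 → ∑ h, e h ≤ D) :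
    l1 (taylor a P) ≤ (1 + b) ^ D * l1 P := by
  classical
  conv_lhs => rw [P.as_sum, map_sum]
  rw [show l1 P = ∑ e ∈ P.support, ‖coeff e P‖ from rfl, Finset.mul_sum]
  refine (l1_sum_le _ _).trans (Finset.sum_le_sum fun e he => ?_)
  rw [taylor, aeval_monomial, Finsupp.prod_fintype _ _ (by simp), algebraMap_eq,
    mul_comm ((1 + b) ^ D)]
  refine (l1_mul_le _ _).trans (mul_le_mul ?_ ?_ (l1_nonneg _) (norm_nonneg _))
  · rw [← monomial_zero', l1_monomial]
  refine (l1_prod_le _ _).trans ?_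
  calc ∏ h, l1 ((X h + C (a h) : MvPolynomial σ ℝ) ^ e h) ≤ ∏ h, (1 + b) ^ e h := by
        refine Finset.prod_le_prod (fun _ _ => l1_nonneg _) fun h _ => ?_
        have h1 : l1 (X h + C (a h) : MvPolynomial σ ℝ) ≤ 1 + b := by
          refine (l1_add_le _ _).trans (add_le_add ?_ ?_)
          · rw [X, l1_monomial, norm_one]
          · rw [← monomial_zero', l1_monomial]
            exact ha h
        have h2 := l1_prod_le (Finset.range (e h)) fun _ => (X h + C (a h) : MvPolynomial σ ℝ)
        rw [Finset.prod_const, Finset.prod_const, Finset.card_range] at h2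
        exact h2.trans (pow_le_pow_left₀ (l1_nonneg _) h1 _)
    _ = (1 + b) ^ ∑ h, e h := Finset.prod_pow_eq_pow_sum _ _ _
    _ ≤ _ := pow_le_pow_right₀ (by linarith) (hD e (mem_support_iff.1 he))

lemma l1_map_intCast_le {σ : Type*} (P : MvPolynomial σ ℤ) :
    l1 (map (Int.castRingHom ℝ) P) ≤ l1 P := by
  rw [l1_eq_sum (support_map_subset (Int.castRingHom ℝ) P)]
  refine Finset.sum_le_sum fun e _ => ?_
  rw [coeff_map, Int.norm_eq_abs, Real.norm_eq_abs]
  rfl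

lemma one_le_prod_den_mul_abs_coeff_taylor {σ : Type*} [Fintype σ] {r : σ → ℕ}
    {P : MvPolynomial σ ℤ} (hdeg : ∀ e, coeff e P ≠ 0 → ∀ h, e h ≤ r h) (x : σ → ℚ) {i : σ →₀ ℕ}
    (hi : coeff i (taylor x (map (Int.castRingHom ℚ) P)) ≠ 0) :
    1 ≤ (∏ h, ((x h).den : ℚ) ^ r h) * |coeff i (taylor x (map (Int.castRingHom ℚ) P))| := by
  have hpos : 0 < ∏ h, ((x h).den : ℚ) ^ r h :=
    Finset.prod_pos fun h _ => pow_pos (by exact_mod_cast (x h).den_pos) _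
  obtain ⟨z, hz⟩ : ∃ z : ℤ,
      (∏ h, ((x h).den : ℚ) ^ r h) * coeff i (taylor x (map (Int.castRingHom ℚ) P)) = z := by
    refine ⟨∑ e ∈ (map (Int.castRingHom ℚ) P).support,
      coeff e P * mchoose e i * ∏ h, ((x h).num ^ (e h - i h) *
        ((x h).den : ℤ) ^ (r h - (e h - i h))), ?_⟩
    rw [coeff_taylor, Finset.mul_sum]
    push_cast
    refine Finset.sum_congr rfl fun e he => ?_
    rw [coeff_map, mul_left_comm, ← Finset.prod_mul_distrib]
    congr 1
    refine Finset.prod_congr rfl fun h _ => ?_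
    have hle : e h - i h ≤ r h := (Nat.sub_le _ _).trans
      (hdeg e (mem_support_iff.1 (support_map_subset _ _ he)) h)
    rw [← Rat.mul_den_eq_num, mul_pow, mul_assoc, ← pow_add, Nat.add_sub_cancel' hle, mul_comm]
  rw [← abs_of_pos hpos, ← abs_mul, hz, ← Int.cast_abs]
  have hz0 : z ≠ 0 := by
    rintro rfl
    rw [Int.cast_zero] at hz
    exact mul_ne_zero hpos.ne' hi hz
  exact_mod_cast Int.one_le_abs hz0

lemma abs_coeff_taylor_le {σ : Type*} [Fintype σ] {r : σ → ℕ} {G : MvPolynomial σ ℝ} {D : ℕ}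
    (hD : ∀ e, coeff e G ≠ 0 → ∑ h, e h ≤ D) {c L : ℝ} (hL : 0 ≤ L) (hG : SuppGE (wt r) c G)
    {y : σ → ℝ} (hy : ∀ h, |y h| ≤ Real.exp (-(L / r h))) (i : σ →₀ ℕ) :
    |coeff i (taylor y G)| ≤ 2 ^ D * l1 G * Real.exp (-(L * (c - wt r i))) := by
  rw [coeff_taylor, show l1 G = ∑ e ∈ G.support, ‖coeff e G‖ from rfl, Finset.mul_sum,
    Finset.sum_mul]
  refine (Finset.abs_sum_le_sum_abs _ _).trans (Finset.sum_le_sum fun e he => ?_)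
  rw [mem_support_iff] at he
  by_cases hie : i ≤ e
  · rw [abs_mul, abs_mul, Nat.abs_cast, Real.norm_eq_abs, mul_comm (2 ^ D : ℝ)]
    gcongr
    · have := (mchoose_le e i).trans (Nat.pow_le_pow_right two_pos (hD e he))
      exact_mod_cast this
    · rw [Finset.abs_prod]
      calc ∏ h, |y h ^ (e h - i h)| ≤ ∏ h, Real.exp (-(L * ((e h : ℝ) / r h - (i h : ℝ) / r h))) := by
            refine Finset.prod_le_prod (fun _ _ => abs_nonneg _) fun h _ => ?_
            rw [abs_pow]
            refine (pow_le_pow_left₀ (abs_nonneg _) (hy h) _).trans_eq ?_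
            rw [← Real.exp_nat_mul, Nat.cast_sub (hie h)]
            congr 1
            ring
        _ = Real.exp (-(L * (wt r e - wt r i))) := by
            rw [← Real.exp_sum, Finset.sum_neg_distrib, ← Finset.mul_sum, Finset.sum_sub_distrib]
            rfl
        _ ≤ _ := by
            gcongr
            exact hG e he
  · rw [mchoose_eq_zero hie]
    simp only [Nat.cast_zero, mul_zero, zero_mul, abs_zero]
    positivity

lemma exists_seq_log_den {p : ℚ → Prop} (hp : ∀ Y : ℝ, ∃ x, Y ≤ Real.log x.den ∧ p x) (K Y : ℝ)
    (hK : 0 ≤ K) (m : ℕ) : ∃ x : Fin m → ℚ, (∀ h, Y ≤ Real.log (x h).den ∧ p (x h)) ∧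
      ∀ i j, i < j → K * Real.log (x j).den ≤ Real.log (x i).den := by
  induction m with
  | zero => exact ⟨fun h => h.elim0, fun h => h.elim0, fun h => h.elim0⟩
  | succ m ih =>
    obtain ⟨x, hx, hord⟩ := ih
    obtain ⟨x₀, hx₀, hpx₀⟩ := hp (max Y (K * ∑ j, Real.log (x j).den))
    refine ⟨Fin.cons x₀ x, Fin.cases ⟨(le_max_left _ _).trans hx₀, hpx₀⟩ hx, fun i j => ?_⟩
    refine Fin.cases (fun hij => absurd hij (Fin.not_lt_zero _)) (fun j => ?_) j
    refine Fin.cases (fun _ => ?_) (fun i hij => hord i j (Fin.succ_lt_succ_iff.1 hij)) i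
    refine le_trans ?_ ((le_max_right _ _).trans hx₀)
    simp only [Fin.cons_succ]
    gcongr
    exact Finset.single_le_sum (f := fun j => Real.log (x j).den)
      (fun _ _ => Real.log_natCast_nonneg _) (Finset.mem_univ j)

end Contradiction

section Main

lemma exists_degree_of_log {m : ℕ} (hm : 0 < m) {q : Fin m → ℝ} {Y η : ℝ} (hY : 0 < Y)
    (hη : 0 < η) (hq : ∀ h, Y ≤ q h) : ∃ (T : ℝ) (r : Fin m → ℕ), 0 < T ∧ (∀ h, 0 < r h) ∧
      ∀ h, T ≤ r h * q h ∧ r h * q h ≤ (1 + η) * T := by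
  have hq0 (h) : 0 < q h := hY.trans_le (hq h)
  have hT : 0 < (∑ h, q h) / η :=
    div_pos (Finset.sum_pos (fun h _ => hq0 h) ⟨⟨0, hm⟩, Finset.mem_univ _⟩) hη
  refine ⟨(∑ h, q h) / η, fun h => ⌈(∑ h, q h) / η / q h⌉₊, hT, fun h => ?_, fun h => ⟨?_, ?_⟩⟩
  · exact Nat.ceil_pos.2 (div_pos hT (hq0 h))
  · rw [← div_le_iff₀ (hq0 h)]
    exact Nat.le_ceil _
  · have h1 := (Nat.ceil_lt_add_one (div_pos hT (hq0 h)).le).le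
    have h2 : q h ≤ η * ((∑ h, q h) / η) := by
      rw [mul_div_cancel₀ _ hη.ne']
      exact Finset.single_le_sum (fun h _ => (hq0 h).le) (Finset.mem_univ h)
    calc _ ≤ ((∑ h, q h) / η / q h + 1) * q h := by
          have := (hq0 h).le
          gcongr
      _ = (∑ h, q h) / η + q h := by
          have := (hq0 h).ne'
          field_simp
      _ ≤ _ := by linarith

/-- Roth's theorem for algebraic integers. -/
theorem roth_of_isIntegral {β : ℝ} (hβ : IsIntegral ℤ β) {δ : ℝ} (hδ : 0 < δ) :
    ∃ B : ℕ, ∀ x : ℚ, B < x.den → (x.den : ℝ) ^ (-(2 + δ)) < |β - x| := by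
  by_contra! hcon
  obtain ⟨c, hc, haux⟩ := exists_auxiliary_polynomial hβ
  set ε := δ / (8 * (2 + δ)) with hε
  have hεδ : (2 + δ) * ε = δ / 8 := by rw [hε]; field_simp
  have hε0 : 0 < ε := by positivity
  have hε1 : ε < 1 / 2 := by nlinarith
  obtain ⟨m, hm, haux⟩ := haux ε hε0 hε1
  have hm1 : (1 : ℝ) ≤ m := by exact_mod_cast hm
  obtain ⟨ω, hω, hroth⟩ := exists_coeff_taylor_ne_zero_of_l1_le m ε hε0
  set η := min 1 (δ / 16) with hη
  have hη0 : 0 < η := lt_min one_pos (by positivity)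
  have hη1 : η ≤ 1 := min_le_left _ _
  have hη2 : η ≤ δ / 16 := min_le_right _ _
  set c₁ := Real.log (2 * (1 + |β|) * c) with hc₁
  have hβ0 := abs_nonneg β
  have hexp : Real.exp c₁ = 2 * (1 + |β|) * c := Real.exp_log (by positivity)
  have hc₁0 : 0 ≤ c₁ := Real.log_nonneg (by nlinarith)
  set ω₁ := min ω (δ / 16) / (c₁ + 1) with hω₁
  have hω₁0 : 0 < ω₁ := div_pos (lt_min hω (by positivity)) (by linarith)
  have hω₁' : (c₁ + 1) * ω₁ ≤ ω ∧ (c₁ + 1) * ω₁ ≤ δ / 16 := by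
    rw [hω₁, mul_div_cancel₀ _ (by linarith)]
    exact ⟨min_le_left _ _, min_le_right _ _⟩
  have hgood (Y : ℝ) : ∃ x : ℚ, Y ≤ Real.log x.den ∧ |β - x| ≤ (x.den : ℝ) ^ (-(2 + δ)) := by
    obtain ⟨x, hx, hxβ⟩ := hcon ⌈Real.exp Y⌉₊
    refine ⟨x, ?_, hxβ⟩
    rw [Real.le_log_iff_exp_le (by exact_mod_cast x.den_pos)]
    exact (Nat.le_ceil _).trans (by exact_mod_cast hx.le)
  obtain ⟨x, hx, hord⟩ := exists_seq_log_den hgood (2 / ω) (2 * m / ω₁) (by positivity) m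
  obtain ⟨T, r, hT, hr, hrT⟩ := exists_degree_of_log hm (q := fun h => Real.log (x h).den)
    (Y := 2 * m / ω₁) (by positivity) hη0 fun h => (hx h).1
  have hlog (h) : 0 < Real.log (x h).den := (by positivity : 0 < 2 * m / ω₁).trans_le (hx h).1
  have hrT2 (h) : r h * Real.log (x h).den ≤ 2 * T := (hrT h).2.trans (by nlinarith)
  set D := ∑ h, r h with hD
  have hDT : (D : ℝ) ≤ ω₁ * T := by
    have h1 (h) : (r h : ℝ) ≤ ω₁ * T / m := by
      rw [le_div_iff₀ (by linarith)]
      have h2 := (hx h).1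
      rw [div_le_iff₀ hω₁0] at h2
      refine le_of_mul_le_mul_right ?_ (hlog h)
      calc (r h : ℝ) * m * Real.log (x h).den = m * (r h * Real.log (x h).den) := by ring
        _ ≤ m * (2 * T) := mul_le_mul_of_nonneg_left (hrT2 h) (by linarith)
        _ = 2 * m * T := by ring
        _ ≤ Real.log (x h).den * ω₁ * T := by gcongr
        _ = _ := by ring
    calc (D : ℝ) = ∑ h, (r h : ℝ) := by rw [hD]; push_cast; rfl
      _ ≤ ∑ _ : Fin m, ω₁ * T / m := Finset.sum_le_sum fun h _ => h1 h
      _ = ω₁ * T := by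
        rw [Finset.sum_const, Finset.card_univ, Fintype.card_fin, nsmul_eq_mul]
        field_simp
  have hD0 : (0 : ℝ) ≤ D := Nat.cast_nonneg _
  have hc₁D : c₁ * D ≤ δ / 16 * T ∧ (c₁ + 1) * D ≤ ω * T := by
    have h1 : (c₁ + 1) * D ≤ (c₁ + 1) * ω₁ * T := by
      rw [mul_assoc]
      exact mul_le_mul_of_nonneg_left hDT (by linarith)
    have h2 := mul_le_mul_of_nonneg_right hω₁'.1 hT.le
    have h3 := mul_le_mul_of_nonneg_right hω₁'.2 hT.le
    constructor <;> linarith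
  have hexpD : Real.exp (c₁ * D) = (2 * (1 + |β|) * c) ^ D := by
    rw [mul_comm, Real.exp_nat_mul, hexp]
  obtain ⟨P, hP0, hPdeg, hPl1, hPidx⟩ := haux r hr
  have hPD (e) (he : coeff e P ≠ 0) : ∑ h, e h ≤ D := Finset.sum_le_sum fun h _ => hPdeg e he h
  obtain ⟨i, hi, hwi⟩ := hroth r x T P hr
    (fun i j hij => by
      have h1 := hord i j hij
      rw [div_mul_eq_mul_div, div_le_iff₀ hω] at h1
      refine le_of_mul_le_mul_right ?_ (hlog i)
      have hrj : (0 : ℝ) ≤ r j := Nat.cast_nonneg _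
      calc (r i : ℝ) * Real.log (x i).den ≤ 2 * T := hrT2 i
        _ ≤ 2 * (r j * Real.log (x j).den) := by linarith [(hrT j).1]
        _ = r j * (2 * Real.log (x j).den) := by ring
        _ ≤ r j * (Real.log (x i).den * ω) := by gcongr
        _ = _ := by ring)
    (fun h => (hrT h).1)
    (by
      have h1 : ∑ h, (r h : ℝ) = D := by rw [hD]; push_cast; rfl
      rw [h1]
      nlinarith [hc₁D.2])
    hP0 hPdeg
    (calc l1 P ≤ c ^ D := hPl1
      _ ≤ (2 * (1 + |β|) * c) ^ D := by
        refine pow_le_pow_left₀ (by linarith) ?_ _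
        nlinarith
      _ = Real.exp (c₁ * D) := hexpD.symm
      _ ≤ _ := Real.exp_le_exp.2 (by linarith [hc₁D.2]))
  set G := taylor (fun _ => β) (map (Int.castRingHom ℝ) P) with hG
  have hGD (e) (he : coeff e G ≠ 0) : ∑ h, e h ≤ D := by
    rw [hG, coeff_taylor] at he
    obtain ⟨e', he', hne⟩ := Finset.exists_ne_zero_of_sum_ne_zero he
    have hle : e ≤ e' := by
      by_contra h
      rw [mchoose_eq_zero h] at hne
      simp at hne
    refine (Finset.sum_le_sum fun h _ => hle h).trans (hPD e' ?_)
    exact mem_support_iff.1 (support_map_subset _ _ he')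
  have hGl1 : l1 G ≤ (1 + |β|) ^ D * c ^ D := by
    refine (l1_taylor_le (b := |β|) _ (fun _ => le_rfl) hβ0 (D := D) fun e he => hPD e ?_).trans ?_
    · exact mem_support_iff.1 (support_map_subset _ _ (mem_support_iff.2 he))
    · gcongr
      exact (l1_map_intCast_le P).trans hPl1
  set z := coeff i (taylor x (map (Int.castRingHom ℚ) P)) with hz
  have hzG : ((z : ℚ) : ℝ) = coeff i (taylor (fun h => (x h : ℝ) - β) G) := by
    have h1 : map (Rat.castHom ℝ) (taylor x (map (Int.castRingHom ℚ) P)) =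
        taylor (fun h => (x h : ℝ) - β) G := by
      rw [map_taylor, map_map, hG, taylor_taylor]
      congr 1
      · congr 1
        ext h
        simp
    rw [← h1, coeff_map]
    rfl
  have hlower : 1 ≤ Real.exp ((1 + η) * T * m) * |(z : ℝ)| := by
    have h1 := one_le_prod_den_mul_abs_coeff_taylor hPdeg x hi
    have h2 : (1 : ℝ) ≤ (∏ h, ((x h).den : ℝ) ^ r h) * |(z : ℝ)| := by exact_mod_cast h1
    refine h2.trans (mul_le_mul_of_nonneg_right ?_ (abs_nonneg _))
    calc ∏ h, ((x h).den : ℝ) ^ r h = ∏ h, Real.exp (r h * Real.log (x h).den) := by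
          refine Finset.prod_congr rfl fun h _ => ?_
          rw [Real.exp_nat_mul, Real.exp_log (by exact_mod_cast (x h).den_pos)]
      _ ≤ ∏ _ : Fin m, Real.exp ((1 + η) * T) :=
          Finset.prod_le_prod (fun _ _ => (Real.exp_pos _).le) fun h _ =>
            Real.exp_le_exp.2 (hrT h).2
      _ = _ := by
          rw [Finset.prod_const, Finset.card_univ, Fintype.card_fin, ← Real.exp_nat_mul, mul_comm]
  have hupper : |(z : ℝ)| ≤
      Real.exp (c₁ * D) * Real.exp (-((2 + δ) * T * (m * (1 / 2 - ε) - wt r i))) := by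
    rw [hzG]
    refine (abs_coeff_taylor_le hGD (by positivity) hPidx (L := (2 + δ) * T) (fun h => ?_) i).trans
      ?_
    · rw [abs_sub_comm]
      refine (hx h).2.trans ?_
      rw [Real.rpow_def_of_pos (by exact_mod_cast (x h).den_pos)]
      refine Real.exp_le_exp.2 ?_
      have hrh : (0 : ℝ) < r h := by exact_mod_cast hr h
      have h1 : T / r h ≤ Real.log (x h).den := by
        rw [div_le_iff₀ hrh, mul_comm]
        exact (hrT h).1
      rw [mul_neg, neg_le_neg_iff, mul_div_assoc, mul_comm]
      gcongr
    · refine mul_le_mul_of_nonneg_right ?_ (Real.exp_pos _).le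
      rw [hexpD, mul_pow, mul_pow, mul_assoc]
      gcongr
  have h1 : Real.exp ((1 + η) * T * m) * |(z : ℝ)| ≤ Real.exp ((1 + η) * T * m +
      (c₁ * D + -((2 + δ) * T * (m * (1 / 2 - ε) - wt r i)))) := by
    rw [Real.exp_add _ (_ + _), Real.exp_add]
    gcongr
  have h2 := Real.exp_le_exp.1 (Real.exp_zero.trans_le (hlower.trans h1))
  have h3 : (2 + δ) * (m * (1 / 2 - ε) - ε) ≤ (2 + δ) * (m * (1 / 2 - ε) - wt r i) := by gcongr
  have h4 : (2 + δ) * (m * (1 / 2 - ε) - ε) = m + m * δ / 2 - (m + 1) * (δ / 8) := by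
    rw [← hεδ]
    ring
  have h5 := mul_le_mul_of_nonneg_right h3 hT.le
  rw [h4] at h5
  have h6 : 0 ≤ (1 + η) * m + δ / 16 - (m + m * δ / 2 - (m + 1) * (δ / 8)) := by
    refine le_of_mul_le_mul_right ?_ hT
    linarith [hc₁D.1]
  nlinarith

end Main

/-- Roth's theorem. -/
theorem exists_le_abs_sub {α : ℝ} (hirr : Irrational α) (halg : IsAlgebraic ℚ α) {ε : ℝ}
    (hε : 0 < ε) : ∃ c : ℝ, 0 < c ∧ ∀ x : ℚ, c * (x.den : ℝ) ^ (-(2 + ε)) ≤ |α - x| := by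
  have halg' : IsAlgebraic ℤ α := (IsFractionRing.isAlgebraic_iff ℤ ℚ ℝ).2 halg
  obtain ⟨d, hd, hint⟩ := halg'.exists_integral_multiple
  rw [zsmul_eq_mul] at hint
  obtain ⟨B, hB⟩ := roth_of_isIntegral hint hε
  have hd1 : (1 : ℝ) ≤ |(d : ℝ)| := by exact_mod_cast Int.one_le_abs hd
  have hd0 : (0 : ℝ) < |(d : ℝ)| := by linarith
  set y : ℝ := (B.factorial : ℝ) * (d * α) with hy
  have hyirr : Irrational y := (hirr.intCast_mul hd).natCast_mul B.factorial_ne_zero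
  have hκ : 0 < |y - round y| := abs_pos.2 (sub_ne_zero.2 (hyirr.ne_int _))
  have hF : (0 : ℝ) < B.factorial := by exact_mod_cast B.factorial_pos
  refine ⟨min 1 (|y - round y| / B.factorial) / |(d : ℝ)|, by positivity, fun x => ?_⟩
  have hpow (q : ℕ) (hq : 0 < q) : (q : ℝ) ^ (-(2 + ε)) ≤ 1 :=
    Real.rpow_le_one_of_one_le_of_nonpos (by exact_mod_cast hq) (by linarith)
  have hx0 : (0 : ℝ) < x.den := by exact_mod_cast x.den_pos
  have hxp : (0 : ℝ) < (x.den : ℝ) ^ (-(2 + ε)) := Real.rpow_pos_of_pos hx0 _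
  have habs : |(d : ℝ) * α - ((d * x : ℚ) : ℝ)| = |(d : ℝ)| * |α - x| := by
    rw [← abs_mul]
    push_cast
    ring_nf
  rw [div_mul_eq_mul_div, div_le_iff₀ hd0, mul_comm |α - x|, ← habs]
  by_cases hden : B < (d * x : ℚ).den
  · have h1 : (d * x : ℚ).den ≤ x.den := by
      have := Rat.mul_den_dvd d x
      rw [Rat.den_intCast, one_mul] at this
      exact Nat.le_of_dvd x.den_pos this
    calc _ ≤ 1 * (x.den : ℝ) ^ (-(2 + ε)) := by
          gcongr
          exact min_le_left _ _
      _ = (x.den : ℝ) ^ (-(2 + ε)) := one_mul _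
      _ ≤ ((d * x : ℚ).den : ℝ) ^ (-(2 + ε)) :=
          Real.rpow_le_rpow_of_nonpos (by exact_mod_cast (d * x : ℚ).den_pos)
            (by exact_mod_cast h1) (by linarith)
      _ ≤ _ := (hB _ hden).le
  · obtain ⟨k, hk⟩ : (d * x : ℚ).den ∣ B.factorial :=
      Nat.dvd_factorial (d * x : ℚ).den_pos (not_lt.1 hden)
    have hz : (B.factorial : ℝ) * ((d * x : ℚ) : ℝ) = ((k * (d * x : ℚ).num : ℤ) : ℝ) := by
      have : (B.factorial : ℚ) * (d * x) = ((k * (d * x : ℚ).num : ℤ) : ℚ) := by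
        rw [hk]
        push_cast
        rw [← Rat.den_mul_eq_num (d * x)]
        ring
      exact_mod_cast this
    calc _ ≤ (|y - round y| / B.factorial) * 1 := by
          gcongr
          · exact min_le_right _ _
          · exact hpow _ x.den_pos
      _ = |y - round y| / B.factorial := mul_one _
      _ ≤ _ := by
          rw [div_le_iff₀ hF]
          refine (round_le y (k * (d * x : ℚ).num)).trans_eq ?_
          rw [← hz, hy, ← mul_sub, abs_mul, abs_of_pos hF, mul_comm]

end Roth

theorem mobius_randomness_stmt10
    (α : ℝ) (hirr : Irrational α) (halg : IsAlgebraic ℚ α)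
    (ε : ℝ) (hε : 0 < ε) :
    ∃ c : ℝ, 0 < c ∧
      ∀ N : ℕ, 2 ≤ N → ∃ r s : ℤ,
        0 < |α - (r : ℝ) / (s : ℝ)| ∧
        |α - (r : ℝ) / (s : ℝ)| ≤ 1 / ((s : ℝ) * (N : ℝ)) ∧
        1 ≤ s ∧ s ≤ (N : ℤ) ∧ Int.gcd r s = 1 ∧
        (c * (N : ℝ)) ^ (1 / (1 + ε)) < (s : ℝ) := by
  obtain ⟨c, hc, hroth⟩ := Roth.exists_le_abs_sub hirr halg hε
  refine ⟨c, hc, fun N hN => ?_⟩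
  obtain ⟨x, hx, hxN⟩ := Real.exists_rat_abs_sub_le_and_den_le α (n := N) (by omega)
  have hN0 : (0 : ℝ) < N := by exact_mod_cast (by omega : 0 < N)
  have hs : (0 : ℝ) < x.den := by exact_mod_cast x.den_pos
  have hcast : ((x.num : ℤ) : ℝ) / ((x.den : ℤ) : ℝ) = x := by
    rw [Int.cast_natCast]
    exact (Rat.cast_def x).symm
  refine ⟨x.num, x.den, ?_, ?_, by exact_mod_cast x.den_pos, by exact_mod_cast hxN, x.reduced, ?_⟩
  · rw [hcast]
    exact abs_pos.2 (sub_ne_zero.2 (hirr.ne_rat x))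
  · rw [hcast, Int.cast_natCast]
    refine hx.trans (one_div_le_one_div_of_le (by positivity) ?_)
    nlinarith
  · rw [Int.cast_natCast]
    have h1 := (hroth x).trans hx
    have h2 : c * N < (x.den : ℝ) ^ (1 + ε) := by
      rw [Real.rpow_neg hs.le, ← div_eq_mul_inv, div_le_div_iff₀ (by positivity) (by positivity),
        one_mul, show 2 + ε = (1 + ε) + 1 by ring, Real.rpow_add_one hs.ne', ← mul_assoc] at h1
      have h3 := le_of_mul_le_mul_right h1 hs
      linarith
    calc (c * (N : ℝ)) ^ (1 / (1 + ε)) < ((x.den : ℝ) ^ (1 + ε)) ^ (1 / (1 + ε)) :=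
          Real.rpow_lt_rpow (by positivity) h2 (by positivity)
      _ = x.den := by
          rw [one_div, Real.rpow_rpow_inv hs.le (by positivity)]
end
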